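/- arXiv:2402.04348 — 4 statements merged into one kernel-verified Lean document; each statement's English description precedes it below -/
import Mathlib

section
/- Let c₁, c₂, c₃, c₄ > 0. Let f ∈ C₀(ℝ) ∩ L¹(ℝ), let m ≥ n ≥ 1 be integers, and let ν be a positive measure in SMZ(m) with constants (c₁,c₂,c₃,c₄). Then there exists a constant c > 0, depending only on (c₁,c₂,c₃,c₄), such that ‖𝔉(f) − 𝔉(S_n(ν;f))‖_∞ ≤ c ‖f − S_n(ν;f)‖_1 ≤ c ( n^{1/2} E_{1,n}(f) + n^{3/2} E_{∞,n}(f) ). -/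
open MeasureTheory Filter ENNReal ProbabilityTheory

noncomputable def psiH (k : ℕ) (x : ℝ) : ℝ :=
  (Real.sqrt Real.pi * 2 ^ k * (Nat.factorial k : ℝ)) ^ (-(1 : ℝ) / 2) * (-1 : ℝ) ^ k *
    Real.exp (x ^ 2 / 2) * iteratedDeriv k (fun t : ℝ => Real.exp (-t ^ 2)) x

noncomputable def PiH (n : ℕ) : Submodule ℝ (ℝ → ℝ) :=
  Submodule.span ℝ {f : ℝ → ℝ | ∃ k, k < n ∧ f = psiH k}

noncomputable def degApproxH (p : ℝ≥0∞) (n : ℕ) (f : ℝ → ℝ) : ℝ≥0∞ :=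
  ⨅ (P : ℝ → ℝ) (_ : P ∈ PiH n), eLpNorm (fun x => f x - P x) p volume

noncomputable def fourierT (f : ℝ → ℝ) (ω : ℝ) : ℂ :=
  (Real.sqrt (2 * Real.pi) : ℂ)⁻¹ * ∫ t : ℝ, (f t : ℂ) * Complex.exp (-(Complex.I * ω * t))

def SMZ (m : ℕ) (c₁ c₂ c₃ c₄ : ℝ) (ν : Measure ℝ) : Prop :=
  (∀ P ∈ PiH m,
      ENNReal.ofReal c₁ * (∫⁻ t : ℝ, ENNReal.ofReal (P t ^ 2)) ≤ (∫⁻ t, ENNReal.ofReal (P t ^ 2) ∂ν) ∧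
      (∫⁻ t, ENNReal.ofReal (P t ^ 2) ∂ν) ≤ ENNReal.ofReal c₂ * (∫⁻ t : ℝ, ENNReal.ofReal (P t ^ 2))) ∧
  ENNReal.ofReal (c₃ * Real.sqrt m) ≤ ν Set.univ ∧ ν Set.univ ≤ ENNReal.ofReal (c₄ * Real.sqrt m)

namespace HermAux

open Polynomial in
/-- weighted polynomial -/
noncomputable def G (p : Polynomial ℝ) (x : ℝ) : ℝ := p.eval x * Real.exp (-x ^ 2 / 2)

lemma G_add (p q : Polynomial ℝ) (x : ℝ) : G (p + q) x = G p x + G q x := by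
  simp [G, add_mul]

lemma G_sub (p q : Polynomial ℝ) (x : ℝ) : G (p - q) x = G p x - G q x := by
  simp [G, sub_mul]

lemma G_X (p : Polynomial ℝ) (x : ℝ) : G (Polynomial.X * p) x = x * G p x := by
  simp [G, mul_assoc]

lemma G_C (a : ℝ) (p : Polynomial ℝ) (x : ℝ) : G (Polynomial.C a * p) x = a * G p x := by
  simp [G, mul_assoc]

lemma G_cont (p : Polynomial ℝ) : Continuous (G p) := by
  unfold G
  have := p.continuous
  fun_prop

lemma G_deriv (p : Polynomial ℝ) (x : ℝ) :
    HasDerivAt (G p) (G (Polynomial.derivative p - Polynomial.X * p) x) x := by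
  have h1 := p.hasDerivAt x
  have h2 : HasDerivAt (fun x : ℝ => -x ^ 2 / 2) (-x) x := by
    have := ((hasDerivAt_pow 2 x).neg).div_const 2
    refine this.congr_deriv ?_
    simp; ring
  refine (h1.mul h2.exp).congr_deriv ?_
  simp [G]
  ring

lemma int_pow_exp (b : ℝ) (hb : 0 < b) (k : ℕ) :
    Integrable (fun x : ℝ => x ^ k * Real.exp (-b * x ^ 2)) := by
  have h := integrable_rpow_mul_exp_neg_mul_sq hb (s := (k : ℝ))
    (by have : (0 : ℝ) ≤ k := k.cast_nonneg
        linarith)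
  simpa using h

lemma int_poly_exp (b : ℝ) (hb : 0 < b) (p : Polynomial ℝ) :
    Integrable (fun x : ℝ => p.eval x * Real.exp (-b * x ^ 2)) := by
  have : (fun x : ℝ => p.eval x * Real.exp (-b * x ^ 2)) =
      fun x => ∑ i ∈ Finset.range (p.natDegree + 1), p.coeff i * (x ^ i * Real.exp (-b * x ^ 2)) := by
    funext x
    rw [Polynomial.eval_eq_sum_range, Finset.sum_mul]
    simp [mul_assoc]
  rw [this]
  exact integrable_finsetSum _ fun i _ => (int_pow_exp b hb i).const_mul _

lemma G_int (p : Polynomial ℝ) : Integrable (G p) := by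
  have := int_poly_exp (1/2) (by norm_num) p
  refine this.congr (ae_of_all _ fun x => ?_)
  simp only [G]
  congr 2
  ring

lemma GG_int (p q : Polynomial ℝ) : Integrable (fun x => G p x * G q x) := by
  have := int_poly_exp 1 (by norm_num) (p * q)
  refine this.congr (ae_of_all _ fun x => ?_)
  simp only [G, Polynomial.eval_mul]
  rw [show -1 * x ^ 2 = -x ^ 2 / 2 + -x ^ 2 / 2 by ring, Real.exp_add]
  ring

lemma G2_int (p : Polynomial ℝ) : Integrable (fun x => G p x ^ 2) := by
  simpa [sq] using GG_int p p

/-- integration by parts -/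
lemma G_ibp (p q : Polynomial ℝ) :
    ∫ x, G (2 * Polynomial.X * p - Polynomial.derivative p) x * G q x =
      ∫ x, G p x * G (Polynomial.derivative q) x := by
  have h := integral_eq_zero_of_hasDerivAt_of_integrable
    (fun x => (G_deriv p x).mul (G_deriv q x))
    ((GG_int _ _).add (GG_int _ _)) (GG_int p q)
  have e : ∀ x, G (2 * Polynomial.X * p - Polynomial.derivative p) x * G q x =
     G p x * G (Polynomial.derivative q) x - (G (Polynomial.derivative p - Polynomial.X * p) x * G q x +
      G p x * G (Polynomial.derivative q - Polynomial.X * q) x) := by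
    intro x
    simp [G]
    ring
  rw [integral_congr_ae (ae_of_all _ e)]
  refine (integral_sub (GG_int _ _) ((GG_int _ _).add (GG_int _ _))).trans ?_
  refine Eq.trans (congrArg _ h) ?_
  simp

lemma G_sup (p : Polynomial ℝ) (x : ℝ) :
    G p x ^ 2 ≤ ∫ t, (G p t ^ 2 + G (Polynomial.derivative p - Polynomial.X * p) t ^ 2) := by
  set q := Polynomial.derivative p - Polynomial.X * p
  have hd : ∀ t, HasDerivAt (fun t => G p t * G p t) (G q t * G p t + G p t * G q t) t :=
    fun t => (G_deriv p t).mul (G_deriv p t)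
  have hi : Integrable (fun t => G q t * G p t + G p t * G q t) := (GG_int _ _).add (GG_int _ _)
  have ht := tendsto_zero_of_hasDerivAt_of_integrableOn_Iic (a := x) (fun t _ => hd t)
    hi.integrableOn (GG_int p p).integrableOn
  have h := integral_Iic_of_hasDerivAt_of_tendsto' (a := x) (fun t _ => hd t) hi.integrableOn ht
  have hi2 : Integrable (fun t => G p t ^ 2 + G q t ^ 2) := (G2_int p).add (G2_int q)
  calc G p x ^ 2 = ∫ t in Set.Iic x, (G q t * G p t + G p t * G q t) := by rw [h]; ring
    _ ≤ ∫ t in Set.Iic x, (G p t ^ 2 + G q t ^ 2) := by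
      apply integral_mono hi.integrableOn hi2.integrableOn
      intro t
      simp only
      nlinarith [sq_nonneg (G p t - G q t)]
    _ ≤ _ := setIntegral_le_integral hi2 (ae_of_all _ fun t => by positivity)

/-- unnormalised Hermite polynomials -/
noncomputable def H : ℕ → Polynomial ℝ
  | 0 => 1
  | k + 1 => 2 * Polynomial.X * H k - Polynomial.derivative (H k)

lemma H_deriv (k : ℕ) : Polynomial.derivative (H (k + 1)) = 2 * (k + 1) * H k := by
  induction k with
  | zero => simp [H]
  | succ k ih =>
    have e : H (k + 1 + 1) = 2 * Polynomial.X * H (k + 1) - Polynomial.derivative (H (k + 1)) := rfl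
    have e2 : H (k + 1) = 2 * Polynomial.X * H k - Polynomial.derivative (H k) := rfl
    rw [e]
    simp only [Polynomial.derivative_sub, Polynomial.derivative_mul, ih]
    simp
    linear_combination (-2 * ((k : Polynomial ℝ) + 1)) * e2

lemma iter_gauss (k : ℕ) :
    iteratedDeriv k (fun t : ℝ => Real.exp (-t ^ 2)) =
      fun x => (-1) ^ k * ((H k).eval x * Real.exp (-x ^ 2)) := by
  induction k with
  | zero => simp [H]
  | succ k ih =>
    rw [iteratedDeriv_succ, ih]
    funext x
    have h1 := (H k).hasDerivAt x
    have h2 : HasDerivAt (fun x : ℝ => -x ^ 2) (-(2 * x)) x := by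
      have := ((hasDerivAt_pow 2 x).neg)
      refine this.congr_deriv ?_
      simp
    have h3 := ((h1.mul h2.exp).const_mul ((-1 : ℝ) ^ k)).deriv
    refine Eq.trans h3 ?_
    simp [H, pow_succ]
    ring

noncomputable def cc (k : ℕ) : ℝ :=
  (Real.sqrt Real.pi * 2 ^ k * (Nat.factorial k : ℝ)) ^ (-(1 : ℝ) / 2)

noncomputable def h (k : ℕ) : Polynomial ℝ := Polynomial.C (cc k) * H k

noncomputable def s (k : ℕ) : ℝ := Real.sqrt (2 * k)

lemma s_sq (k : ℕ) : s k ^ 2 = 2 * k := by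
  unfold s
  exact Real.sq_sqrt (by positivity)

lemma s_nonneg (k : ℕ) : 0 ≤ s k := Real.sqrt_nonneg _

lemma s_pos (k : ℕ) : 0 < s (k + 1) := Real.sqrt_pos.2 (by positivity)

lemma cc_pos (k : ℕ) : 0 < cc k := by
  unfold cc
  have := Real.pi_pos
  positivity

lemma cc_succ (k : ℕ) : s (k + 1) * cc (k + 1) = cc k := by
  have hpi := Real.pi_pos
  have e : Real.sqrt Real.pi * 2 ^ (k + 1) * (Nat.factorial (k + 1) : ℝ) =
    (2 * ((k + 1 : ℕ) : ℝ)) * (Real.sqrt Real.pi * 2 ^ k * (Nat.factorial k : ℝ)) := by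
    rw [Nat.factorial_succ]
    push_cast
    ring
  unfold cc s
  rw [e, Real.mul_rpow (by positivity) (by positivity), ← mul_assoc, Real.sqrt_eq_rpow,
    ← Real.rpow_add (by positivity)]
  norm_num

lemma psi_eq (k : ℕ) : psiH k = G (h k) := by
  funext x
  unfold psiH
  rw [iter_gauss]
  have e1 : Real.exp (x ^ 2 / 2) * Real.exp (-x ^ 2) = Real.exp (-x ^ 2 / 2) := by
    rw [← Real.exp_add]
    congr 1
    ring
  have e2 : ((-1 : ℝ) ^ k) * (-1) ^ k = 1 := by
    rw [← mul_pow]; simp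
  change cc k * (-1 : ℝ) ^ k * Real.exp (x ^ 2 / 2) * ((-1) ^ k * ((H k).eval x * Real.exp (-x ^ 2))) = _
  simp only [G, h, Polynomial.eval_mul, Polynomial.eval_C]
  linear_combination (cc k * Polynomial.eval x (H k)) * e1 +
    (cc k * Polynomial.eval x (H k) * Real.exp (x ^ 2 / 2) * Real.exp (-x ^ 2)) * e2

lemma h_raise (k : ℕ) : Polynomial.C (s (k + 1)) * h (k + 1) =
    2 * Polynomial.X * h k - Polynomial.derivative (h k) := by
  unfold h
  rw [← mul_assoc, ← Polynomial.C_mul, cc_succ]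
  simp [H]
  ring

lemma h_lower (k : ℕ) : Polynomial.derivative (h (k + 1)) = Polynomial.C (s (k + 1)) * h k := by
  unfold h
  rw [Polynomial.derivative_C_mul, H_deriv]
  have e : (2 * ((k : Polynomial ℝ) + 1)) = Polynomial.C (s (k + 1) ^ 2) := by
    rw [s_sq]
    rw [Polynomial.C_mul, Polynomial.C_ofNat]
    simp
  rw [e, ← cc_succ k]
  simp only [map_mul, map_pow]
  ring

lemma h_lower0 : Polynomial.derivative (h 0) = 0 := by
  simp [h, H]

/-- the derivative of the k-th function -/
lemma rec_psi (k : ℕ) (x : ℝ) :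
    s (k + 2) * G (h (k + 2)) x = 2 * x * G (h (k + 1)) x - s (k + 1) * G (h k) x := by
  rw [← G_C, h_raise, h_lower]
  simp [G]
  ring

lemma rec_psi0 (x : ℝ) : s 1 * G (h 1) x = 2 * x * G (h 0) x := by
  rw [← G_C, h_raise 0, h_lower0]
  simp [G]
  ring

lemma orth (j k : ℕ) : ∫ x, G (h j) x * G (h k) x = if j = k then 1 else 0 := by
  induction j generalizing k with
  | zero =>
    cases k with
    | zero =>
      have hpi := Real.pi_pos
      have : ∀ x, G (h 0) x * G (h 0) x = (Real.sqrt Real.pi)⁻¹ * Real.exp (-1 * x ^ 2) := by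
        intro x
        simp [G, h, H, cc]
        rw [show -x ^ 2 = -x ^ 2 / 2 + -x ^ 2 / 2 by ring, Real.exp_add]
        have : (Real.sqrt Real.pi ^ (-1 / 2 : ℝ)) * (Real.sqrt Real.pi ^ (-1 / 2 : ℝ)) = (Real.sqrt Real.pi)⁻¹ := by
          rw [← Real.rpow_add (by positivity)]
          norm_num
          rw [Real.rpow_neg_one]
        rw [← this]
        ring
      simp only [this]
      rw [integral_const_mul, integral_gaussian]
      have : Real.sqrt Real.pi ≠ 0 := by positivity
      simp [this]
    | succ k =>
      have := G_ibp (h k) (h 0)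
      rw [← h_raise, h_lower0] at this
      simp only [G_C] at this
      simp only [mul_assoc, integral_const_mul] at this
      simp [G] at this
      rcases this with h1 | h1
      · exact absurd h1 (s_pos k).ne'
      · simp
        rw [← h1]
        congr 1
        funext x
        simp [G]; ring
  | succ j ih =>
    have := G_ibp (h j) (h k)
    rw [← h_raise] at this
    simp only [G_C] at this
    simp only [mul_assoc, integral_const_mul] at this
    cases k with
    | zero =>
      rw [h_lower0] at this
      simp [G] at this
      rcases this with h1 | h1
      · exact absurd h1 (s_pos j).ne'
      · simp
        rw [← h1]
        congr 1
    | succ k =>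
      rw [h_lower] at this
      simp only [G_C] at this
      have e : ∀ x, G (h j) x * (s (k + 1) * G (h k) x) = s (k + 1) * (G (h j) x * G (h k) x) := by
        intro x; ring
      simp only [e, integral_const_mul, ih] at this
      have hp := s_pos j
      by_cases hjk : j = k
      · subst hjk
        simp at this ⊢
        have := mul_left_cancel₀ (a := s (j + 1)) hp.ne' (this.trans (mul_one _).symm)
        exact this
      · simp [hjk] at this ⊢
        rcases this with h1 | h1
        · exact absurd h1 hp.ne'
        · exact h1

end HermAux
namespace HermAux

noncomputable def pp (n : ℕ) (a : ℕ → ℝ) : Polynomial ℝ :=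
  ∑ k ∈ Finset.range n, Polynomial.C (a k) * h k

lemma G_pp (n : ℕ) (a : ℕ → ℝ) (x : ℝ) :
    G (pp n a) x = ∑ k ∈ Finset.range n, a k * G (h k) x := by
  simp only [G, pp, Polynomial.eval_finsetSum, Finset.sum_mul, Polynomial.eval_mul, Polynomial.eval_C,
    mul_assoc]

lemma pp_mem (n : ℕ) (a : ℕ → ℝ) : G (pp n a) ∈ PiH n := by
  have : G (pp n a) = ∑ k ∈ Finset.range n, a k • psiH k := by
    funext x
    simp [G_pp, psi_eq]
  rw [this]
  refine Submodule.sum_mem _ fun k hk => Submodule.smul_mem _ _ (Submodule.subset_span ?_)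
  exact ⟨k, Finset.mem_range.1 hk, rfl⟩

lemma mem_pp {n : ℕ} {Q : ℝ → ℝ} (hQ : Q ∈ PiH n) : ∃ a, Q = G (pp n a) := by
  induction hQ using Submodule.span_induction with
  | mem x hx =>
    obtain ⟨k, hk, rfl⟩ := hx
    refine ⟨fun j => if j = k then 1 else 0, ?_⟩
    funext x
    rw [G_pp]
    simp [hk, psi_eq]
  | zero => exact ⟨0, by funext x; simp [G_pp]⟩
  | add x y _ _ hx hy =>
    obtain ⟨a, rfl⟩ := hx
    obtain ⟨b, rfl⟩ := hy
    refine ⟨a + b, ?_⟩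
    funext x
    simp [G_pp, add_mul, Finset.sum_add_distrib]
  | smul c x _ hx =>
    obtain ⟨a, rfl⟩ := hx
    refine ⟨c • a, ?_⟩
    funext x
    simp [G_pp, Finset.mul_sum, mul_assoc]

lemma norm_pp (n : ℕ) (a : ℕ → ℝ) :
    ∫ x, G (pp n a) x ^ 2 = ∑ k ∈ Finset.range n, a k ^ 2 := by
  have e : ∀ x, G (pp n a) x ^ 2 =
      ∑ j ∈ Finset.range n, ∑ k ∈ Finset.range n, a j * a k * (G (h j) x * G (h k) x) := by
    intro x
    rw [G_pp, sq, Finset.sum_mul_sum]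
    refine Finset.sum_congr rfl fun j _ => Finset.sum_congr rfl fun k _ => by ring
  simp only [e]
  rw [integral_finsetSum]
  · refine Finset.sum_congr rfl fun j hj => ?_
    rw [integral_finsetSum]
    · simp only [integral_const_mul, orth]
      have := Finset.mem_range.1 hj
      simp [this]
      ring
    · intro k _
      exact (GG_int _ _).const_mul _
  · intro j _
    exact integrable_finsetSum _ fun k _ => (GG_int _ _).const_mul _

lemma deriv_pp (n : ℕ) (a : ℕ → ℝ) : Polynomial.derivative (pp (n + 1) a) =
    pp n (fun k => a (k + 1) * s (k + 1)) := by
  unfold pp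
  rw [Finset.sum_range_succ']
  simp [h_lower, h_lower0, mul_assoc]

lemma raise_pp (n : ℕ) (a : ℕ → ℝ) : 2 * Polynomial.X * pp n a - Polynomial.derivative (pp n a) =
    pp (n + 1) (fun k => if k = 0 then 0 else a (k - 1) * s k) := by
  unfold pp
  rw [Finset.sum_range_succ']
  simp only [Finset.mul_sum, map_sum, ← Finset.sum_sub_distrib]
  simp only [if_true, Nat.succ_ne_zero, if_false, map_zero, zero_mul, add_zero, Nat.add_sub_cancel]
  refine Finset.sum_congr rfl (fun k _ => ?_)
  rw [Polynomial.C_mul, mul_assoc (Polynomial.C (a k)), h_raise, Polynomial.derivative_C_mul]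
  ring

lemma deriv_bound (n : ℕ) (a : ℕ → ℝ) : ∫ x, G (Polynomial.derivative (pp n a)) x ^ 2 ≤
    2 * n * ∫ x, G (pp n a) x ^ 2 := by
  cases n with
  | zero => simp [pp, G]
  | succ n =>
    rw [deriv_pp, norm_pp, norm_pp, Finset.sum_range_succ', mul_add, Finset.mul_sum]
    have : ∀ k ∈ Finset.range n, (a (k + 1) * s (k + 1)) ^ 2 ≤ 2 * ((n + 1 : ℕ) : ℝ) * a (k + 1) ^ 2 := by
      intro k hk
      have : ((k + 1 : ℕ) : ℝ) ≤ ((n + 1 : ℕ) : ℝ) := by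
        exact_mod_cast (by have := Finset.mem_range.1 hk; omega)
      rw [mul_pow, s_sq]
      nlinarith [sq_nonneg (a (k + 1))]
    have h2 := Finset.sum_le_sum this
    have h3 : 0 ≤ 2 * ((n + 1 : ℕ) : ℝ) * a 0 ^ 2 := by positivity
    linarith

lemma raise_bound (n : ℕ) (a : ℕ → ℝ) :
    ∫ x, G (2 * Polynomial.X * pp n a - Polynomial.derivative (pp n a)) x ^ 2 ≤
    2 * n * ∫ x, G (pp n a) x ^ 2 := by
  rw [raise_pp, norm_pp, norm_pp, Finset.sum_range_succ', Finset.mul_sum]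
  simp only [if_true, Nat.succ_ne_zero, if_false]
  simp
  refine Finset.sum_le_sum fun k hk => ?_
  have : ((k + 1 : ℕ) : ℝ) ≤ (n : ℝ) := by
    exact_mod_cast (by have := Finset.mem_range.1 hk; omega)
  rw [mul_pow, s_sq]
  nlinarith [sq_nonneg (a k)]

lemma moment (n : ℕ) (a : ℕ → ℝ) :
    (∫ x, G (Polynomial.X * pp n a) x ^ 2) +
      ∫ x, G (Polynomial.derivative (pp n a) - Polynomial.X * pp n a) x ^ 2 ≤
    2 * n * ∫ x, G (pp n a) x ^ 2 := by
  rw [← integral_add (G2_int _) (G2_int _)]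
  have e : ∀ x, G (Polynomial.X * pp n a) x ^ 2 +
      G (Polynomial.derivative (pp n a) - Polynomial.X * pp n a) x ^ 2 =
      (1 / 2) * (G (Polynomial.derivative (pp n a)) x ^ 2 +
        G (2 * Polynomial.X * pp n a - Polynomial.derivative (pp n a)) x ^ 2) := by
    intro x
    simp [G]
    ring
  simp only [e]
  rw [integral_const_mul, integral_add (G2_int _) (G2_int _)]
  linarith [deriv_bound n a, raise_bound n a]

lemma X_mem (n : ℕ) (a : ℕ → ℝ) : ∃ b, ∀ x, G (pp (n + 1) b) x = x * G (pp n a) x := by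
  have h1 := raise_pp n a
  set b : ℕ → ℝ := (fun k => if k = 0 then 0 else a (k - 1) * s k)
  have h2 : ∃ d, Polynomial.derivative (pp n a) = pp (n + 1) d := by
    cases n with
    | zero => exact ⟨0, by simp [pp]⟩
    | succ n =>
      refine ⟨fun k => if k < n then a (k + 1) * s (k + 1) else 0, ?_⟩
      rw [deriv_pp]
      unfold pp
      rw [Finset.sum_range_succ, Finset.sum_range_succ]
      simp
      refine Finset.sum_congr rfl fun k hk => ?_
      simp [Finset.mem_range.1 hk]
  obtain ⟨d, hd⟩ := h2
  refine ⟨fun k => (b k + d k) / 2, fun x => ?_⟩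
  have e1 : G (pp (n + 1) (fun k => (b k + d k) / 2)) x = (G (pp (n + 1) b) x + G (pp (n + 1) d) x) / 2 := by
    simp only [G_pp]
    rw [← Finset.sum_add_distrib, Finset.sum_div]
    refine Finset.sum_congr rfl fun k hk => by ring
  rw [e1, ← h1, ← hd]
  simp [G]
  ring

/-- Cauchy-Schwarz -/
lemma cs {μ : Measure ℝ} {f g : ℝ → ℝ} (hf : Integrable (fun x => f x ^ 2) μ)
    (hg : Integrable (fun x => g x ^ 2) μ) (hfg : Integrable (fun x => f x * g x) μ) :
    (∫ x, f x * g x ∂μ) ^ 2 ≤ (∫ x, f x ^ 2 ∂μ) * ∫ x, g x ^ 2 ∂μ := by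
  have : ∀ t : ℝ, 0 ≤ (∫ x, f x ^ 2 ∂μ) * (t * t) + (2 * ∫ x, f x * g x ∂μ) * t + ∫ x, g x ^ 2 ∂μ := by
    intro t
    have h0 : 0 ≤ ∫ x, (f x * t + g x) ^ 2 ∂μ := integral_nonneg fun x => sq_nonneg _
    have e : ∀ x, (f x * t + g x) ^ 2 = (t * t) * f x ^ 2 + ((2 * t) * (f x * g x) + g x ^ 2) := by
      intro x; ring
    simp only [e] at h0
    have i1 : Integrable (fun x => (2 * t) * (f x * g x) + g x ^ 2) μ := (hfg.const_mul _).add hg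
    rw [integral_add (hf.const_mul _) i1, integral_add (hfg.const_mul _) hg,
      integral_const_mul, integral_const_mul] at h0
    linarith
  have := discrim_le_zero this
  unfold discrim at this
  linarith

lemma int_one_add (n : ℕ) (hn : 1 ≤ n) (a : ℕ → ℝ) :
    ∫ x, (1 + x ^ 2) * G (pp n a) x ^ 2 ≤ 3 * n * ∫ x, G (pp n a) x ^ 2 := by
  have e : ∀ x, (1 + x ^ 2) * G (pp n a) x ^ 2 = G (pp n a) x ^ 2 + G (Polynomial.X * pp n a) x ^ 2 := by
    intro x
    rw [G_X]; ring
  simp only [e]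
  rw [integral_add (G2_int _) (G2_int _)]
  have h1 := moment n a
  have h2 : 0 ≤ ∫ x, G (Polynomial.derivative (pp n a) - Polynomial.X * pp n a) x ^ 2 :=
    integral_nonneg fun x => sq_nonneg _
  have h3 : 0 ≤ ∫ x, G (pp n a) x ^ 2 := integral_nonneg fun x => sq_nonneg _
  have h4 : (1 : ℝ) ≤ n := by exact_mod_cast hn
  nlinarith

lemma sup_bound (n : ℕ) (hn : 1 ≤ n) (a : ℕ → ℝ) (x : ℝ) :
    G (pp n a) x ^ 2 ≤ 3 * n * ∫ x, G (pp n a) x ^ 2 := by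
  refine (G_sup _ x).trans ?_
  rw [integral_add (G2_int _) (G2_int _)]
  have h1 := moment n a
  have h2 : 0 ≤ ∫ x, G (Polynomial.X * pp n a) x ^ 2 :=
    integral_nonneg fun x => sq_nonneg _
  have h3 : 0 ≤ ∫ x, G (pp n a) x ^ 2 := integral_nonneg fun x => sq_nonneg _
  have h4 : (1 : ℝ) ≤ n := by exact_mod_cast hn
  nlinarith

lemma l1_bound (n : ℕ) (hn : 1 ≤ n) (a : ℕ → ℝ) :
    (∫ x, |G (pp n a) x|) ^ 2 ≤ 3 * Real.pi * n * ∫ x, G (pp n a) x ^ 2 := by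
  have hpos : ∀ x : ℝ, 0 < Real.sqrt (1 + x ^ 2) := fun x => Real.sqrt_pos.2 (by positivity)
  have hsq : ∀ x : ℝ, Real.sqrt (1 + x ^ 2) ^ 2 = 1 + x ^ 2 := fun x => Real.sq_sqrt (by positivity)
  have e1 : ∀ x : ℝ, ((Real.sqrt (1 + x ^ 2))⁻¹) ^ 2 = (1 + x ^ 2)⁻¹ := by
    intro x
    rw [inv_pow, hsq]
  have e2 : ∀ x : ℝ, (Real.sqrt (1 + x ^ 2) * |G (pp n a) x|) ^ 2 = (1 + x ^ 2) * G (pp n a) x ^ 2 := by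
    intro x
    rw [mul_pow, hsq, sq_abs]
  have e3 : ∀ x : ℝ, (Real.sqrt (1 + x ^ 2))⁻¹ * (Real.sqrt (1 + x ^ 2) * |G (pp n a) x|) = |G (pp n a) x| := by
    intro x
    rw [← mul_assoc, inv_mul_cancel₀ (hpos x).ne', one_mul]
  have i2 : Integrable (fun x => (1 + x ^ 2) * G (pp n a) x ^ 2) := by
    refine ((G2_int (pp n a)).add (G2_int (Polynomial.X * pp n a))).congr (ae_of_all _ fun x => ?_)
    simp only [Pi.add_apply, G_X]
    ring
  have := cs (μ := volume) (f := fun x => (Real.sqrt (1 + x ^ 2))⁻¹)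
    (g := fun x => Real.sqrt (1 + x ^ 2) * |G (pp n a) x|) (by simpa only [e1] using integrable_inv_one_add_sq)
    (by simpa only [e2] using i2) (by simpa only [e3] using (G_int (pp n a)).abs)
  simp only [e1, e2, e3] at this
  rw [integral_univ_inv_one_add_sq] at this
  have h1 := int_one_add n hn a
  have hpi := Real.pi_pos
  nlinarith

lemma l2_l1 (n : ℕ) (hn : 1 ≤ n) (a : ℕ → ℝ) :
    ∫ x, G (pp n a) x ^ 2 ≤ 3 * n * (∫ x, |G (pp n a) x|) ^ 2 := by
  set A := ∫ x, G (pp n a) x ^ 2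
  set B := ∫ x, |G (pp n a) x|
  have hA : 0 ≤ A := integral_nonneg fun x => sq_nonneg _
  have hB : 0 ≤ B := integral_nonneg fun x => abs_nonneg _
  have hs : ∀ x, |G (pp n a) x| ≤ Real.sqrt (3 * n * A) := fun x =>
    Real.abs_le_sqrt (sup_bound n hn a x)
  have h1 : A ≤ Real.sqrt (3 * n * A) * B := by
    rw [← integral_const_mul]
    apply integral_mono (G2_int _) ((G_int _).abs.const_mul _)
    intro x
    simp only
    rw [← sq_abs, sq]
    exact mul_le_mul_of_nonneg_right (hs x) (abs_nonneg _)
  have h2 : A ^ 2 ≤ 3 * n * A * B ^ 2 := by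
    have := pow_le_pow_left₀ hA h1 2
    rwa [mul_pow, Real.sq_sqrt (by positivity)] at this
  rcases hA.eq_or_lt with h0 | h0
  · rw [← h0]; positivity
  · have : A * A ≤ A * (3 * n * B ^ 2) := by nlinarith
    exact le_of_mul_le_mul_left this h0

lemma range_ineq (n : ℕ) (hn : 1 ≤ n) (a : ℕ → ℝ) (R : ℝ) (hR : R = 22 * (n : ℝ) ^ ((3 : ℝ) / 2)) :
    ∫ x, |G (pp n a) x| ≤ 2 * ∫ x in Set.Icc (-R) R, |G (pp n a) x| := by
  have hn' : (1 : ℝ) ≤ n := by exact_mod_cast hn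
  have hR0 : 0 < R := by rw [hR]; positivity
  have hR2 : R ^ 2 = 484 * (n : ℝ) ^ 3 := by
    rw [hR, mul_pow, ← Real.rpow_natCast ((n : ℝ) ^ ((3 : ℝ) / 2)), ← Real.rpow_mul (by positivity)]
    norm_num
  obtain ⟨b, hb⟩ := X_mem n a
  have h1 := l1_bound (n + 1) (by omega) b
  have h2 := moment n a
  have h2' : 0 ≤ ∫ x, G (Polynomial.derivative (pp n a) - Polynomial.X * pp n a) x ^ 2 :=
    integral_nonneg fun x => sq_nonneg _
  have h3 := l2_l1 n hn a
  have e : ∀ x, G (pp (n + 1) b) x = G (Polynomial.X * pp n a) x := fun x => by rw [hb, G_X]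
  have hxi : Integrable (fun x => |x * G (pp n a) x|) := by
    simpa only [← hb] using (G_int (pp (n + 1) b)).abs
  have h1e : (∫ x, G (pp (n + 1) b) x ^ 2) = ∫ x, G (Polynomial.X * pp n a) x ^ 2 := by simp only [e]
  have h1f : (∫ x, |G (pp (n + 1) b) x|) = ∫ x, |x * G (pp n a) x| := by simp only [hb]
  rw [h1e, h1f] at h1
  set B := ∫ x, |G (pp n a) x| with hBdef
  have hB : 0 ≤ B := integral_nonneg fun x => abs_nonneg _
  set D := ∫ x, |x * G (pp n a) x|
  have hD : 0 ≤ D := integral_nonneg fun x => abs_nonneg _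
  set X2 := ∫ x, G (Polynomial.X * pp n a) x ^ 2
  set A := ∫ x, G (pp n a) x ^ 2
  have hX2 : X2 ≤ 2 * n * (3 * n * B ^ 2) := by
    have : 2 * (n : ℝ) * A ≤ 2 * n * (3 * n * B ^ 2) := by gcongr
    linarith
  have hD2 : D ^ 2 ≤ (R * B / 2) ^ 2 := by
    have hpi := Real.pi_lt_d2
    have hpi0 := Real.pi_pos
    push_cast at h1
    calc D ^ 2 ≤ 3 * Real.pi * (n + 1) * X2 := h1
      _ ≤ 3 * 3.15 * (2 * n) * (2 * n * (3 * n * B ^ 2)) := by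
        gcongr
        linarith
      _ ≤ 121 * n ^ 3 * B ^ 2 := by
        have : 0 ≤ (n : ℝ) ^ 3 * B ^ 2 := by positivity
        nlinarith
      _ = (R * B / 2) ^ 2 := by rw [div_pow, mul_pow, hR2]; ring
  have hDR : D ≤ R * B / 2 := by
    exact (pow_le_pow_iff_left₀ hD (by positivity) (by norm_num)).1 hD2
  have hsplit := integral_add_compl (μ := volume) (s := Set.Icc (-R) R) measurableSet_Icc (G_int (pp n a)).abs
  have htail : R * (∫ x in (Set.Icc (-R) R)ᶜ, |G (pp n a) x|) ≤ D := by
    rw [← integral_const_mul]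
    refine le_trans (setIntegral_mono_on ((G_int _).abs.const_mul _).integrableOn hxi.integrableOn
      measurableSet_Icc.compl ?_) (setIntegral_le_integral hxi (ae_of_all _ fun x => abs_nonneg _))
    intro x hx
    rw [abs_mul]
    refine mul_le_mul_of_nonneg_right ?_ (abs_nonneg _)
    by_contra hc
    exact hx (abs_le.1 (not_le.1 hc).le)
  simp only [← hBdef] at hsplit
  have : R * (∫ x in (Set.Icc (-R) R)ᶜ, |G (pp n a) x|) ≤ R * (B / 2) := by linarith
  have := le_of_mul_le_mul_left this hR0
  linarith

end HermAux
namespace HermAux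

noncomputable def K (N : ℕ) (x : ℝ) : ℝ := ∑ k ∈ Finset.range N, G (h k) x ^ 2

lemma K_id (N : ℕ) (x : ℝ) : K (N + 1) x =
    (N + 1) * (G (h N) x ^ 2 + G (h (N + 1)) x ^ 2) - s (N + 1) * x * (G (h N) x * G (h (N + 1)) x) := by
  induction N with
  | zero =>
    have h0 := rec_psi0 x
    have h1 := s_sq 1
    simp [K] at h0 h1 ⊢
    linear_combination (G (h 1) x ^ 2 / 2) * h1 - (s 1 * G (h 1) x) / 2 * h0
  | succ N ih =>
    have h0 := rec_psi N x
    have h1 := s_sq (N + 1)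
    have h2 := s_sq (N + 2)
    have e : K (N + 1 + 1) x = K (N + 1) x + G (h (N + 1)) x ^ 2 := Finset.sum_range_succ _ _
    rw [e, ih]
    push_cast at h1 h2 ⊢
    simp only [show N + 1 + 1 = N + 2 from rfl]
    set a := G (h N) x
    set b := G (h (N + 1)) x
    set c := G (h (N + 2)) x
    linear_combination (c ^ 2 / 2) * h2 - (a ^ 2 / 2) * h1 -
      ((s (N + 2) * c - s (N + 1) * a) / 2) * h0

lemma psi_deriv (k : ℕ) (x : ℝ) :
    HasDerivAt (G (h k)) (x * G (h k) x - s (k + 1) * G (h (k + 1)) x) x := by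
  refine (G_deriv (h k) x).congr_deriv ?_
  rw [← G_C (s (k + 1)), h_raise]
  simp [G]
  ring

lemma K_deriv (N : ℕ) (x : ℝ) :
    HasDerivAt (K (N + 1)) (-(s (N + 1) * (G (h N) x * G (h (N + 1)) x))) x := by
  induction N with
  | zero =>
    have e : K (0 + 1) = fun x => G (h 0) x ^ 2 := by funext y; simp [K]
    rw [e]
    refine ((psi_deriv 0 x).pow 2).congr_deriv ?_
    have h0 := rec_psi0 x
    simp
    linear_combination (-G (h 0) x) * h0
  | succ N ih =>
    have e : K (N + 1 + 1) = fun x => K (N + 1) x + G (h (N + 1)) x ^ 2 := by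
      funext y; exact Finset.sum_range_succ _ _
    rw [e]
    refine (ih.add ((psi_deriv (N + 1) x).pow 2)).congr_deriv ?_
    have h0 := rec_psi N x
    simp
    linear_combination (-G (h (N + 1)) x) * h0

noncomputable def kap : ℝ := Real.exp (-1) * G (h 0) 0 ^ 2

lemma kap_pos : 0 < kap := by
  unfold kap
  have : G (h 0) 0 = cc 0 := by simp [G, h, H]
  rw [this]
  have := cc_pos 0
  positivity

lemma K_lower (N : ℕ) (hN : 1 ≤ N) (x : ℝ) (hx : 2 * x ^ 2 ≤ N) : kap ≤ K N x := by
  obtain ⟨N, rfl⟩ : ∃ M, N = M + 1 := ⟨N - 1, by omega⟩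
  have hd : ∀ t : ℝ, HasDerivAt (fun t => K (N + 1) (t * x) * Real.exp t)
      (-(s (N + 1) * (G (h N) (t * x) * G (h (N + 1)) (t * x))) * x * Real.exp t +
        K (N + 1) (t * x) * Real.exp t) t := by
    intro t
    have h1 : HasDerivAt (fun t : ℝ => t * x) x t := by simpa using (hasDerivAt_id t).mul_const x
    exact ((K_deriv N (t * x)).comp t h1).mul (Real.hasDerivAt_exp t)
  have hm : MonotoneOn (fun t => K (N + 1) (t * x) * Real.exp t) (Set.Icc 0 1) := by
    apply monotoneOn_of_deriv_nonneg (convex_Icc 0 1)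
    · exact fun t _ => (hd t).continuousAt.continuousWithinAt
    · exact fun t _ => (hd t).differentiableAt.differentiableWithinAt
    · intro t ht
      rw [interior_Icc] at ht
      rw [(hd t).deriv, K_id]
      set a := G (h N) (t * x)
      set b := G (h (N + 1)) (t * x)
      have hs := s_sq (N + 1)
      have hs0 := s_nonneg (N + 1)
      push_cast at hs hx
      have h1 : (s (N + 1) * |x|) ^ 2 ≤ ((N : ℝ) + 1) ^ 2 := by
        rw [mul_pow, hs, sq_abs]
        have : (0 : ℝ) ≤ N + 1 := by positivity
        nlinarith
      have h2 : s (N + 1) * |x| ≤ N + 1 :=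
        (pow_le_pow_iff_left₀ (by positivity) (by positivity) (by norm_num)).1 h1
      have h3 : s (N + 1) * (t + 1) * x * (a * b) ≤ ((N : ℝ) + 1) * (a ^ 2 + b ^ 2) := by
        calc s (N + 1) * (t + 1) * x * (a * b) ≤ |s (N + 1) * (t + 1) * x * (a * b)| := le_abs_self _
          _ = (s (N + 1) * |x|) * (t + 1) * (|a| * |b|) := by
            rw [abs_mul, abs_mul, abs_mul, abs_mul, abs_of_nonneg hs0,
              abs_of_nonneg (by linarith [ht.1] : 0 ≤ t + 1)]
            ring
          _ ≤ ((N : ℝ) + 1) * 2 * (|a| * |b|) := by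
            have := ht.1
            have := ht.2
            gcongr
            linarith
          _ ≤ _ := by
            rw [mul_assoc]
            gcongr
            nlinarith [sq_nonneg (|a| - |b|), sq_abs a, sq_abs b]
      have h4 := Real.exp_pos t
      have h5 : 0 ≤ (((N : ℝ) + 1) * (a ^ 2 + b ^ 2) - s (N + 1) * (t + 1) * x * (a * b)) * Real.exp t :=
        mul_nonneg (by linarith) h4.le
      linarith
  have := hm (Set.left_mem_Icc.2 zero_le_one) (Set.right_mem_Icc.2 zero_le_one) zero_le_one
  simp at this
  have h0 : G (h 0) 0 ^ 2 ≤ K (N + 1) 0 :=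
    Finset.single_le_sum (f := fun k => G (h k) 0 ^ 2) (fun k _ => sq_nonneg _) (Finset.mem_range.2 (by omega))
  unfold kap
  rw [Real.exp_neg, inv_mul_le_iff₀ (Real.exp_pos _)]
  linarith

lemma G_bdd (p : Polynomial ℝ) : ∃ C, ∀ x, |G p x| ≤ C :=
  ⟨_, fun x => Real.abs_le_sqrt (G_sup p x)⟩

lemma int_of_bdd {ν : Measure ℝ} [IsFiniteMeasure ν] {f : ℝ → ℝ} (hc : Continuous f) {C : ℝ}
    (hC : ∀ x, |f x| ≤ C) : Integrable f ν :=
  Integrable.of_bound hc.aestronglyMeasurable C (ae_of_all _ hC)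

lemma GG_nu (ν : Measure ℝ) [IsFiniteMeasure ν] (p q : Polynomial ℝ) :
    Integrable (fun x => G p x * G q x) ν := by
  obtain ⟨C, hC⟩ := G_bdd p
  obtain ⟨D, hD⟩ := G_bdd q
  refine int_of_bdd ((G_cont p).mul (G_cont q)) (C := C * D) fun x => ?_
  rw [abs_mul]
  exact mul_le_mul (hC x) (hD x) (abs_nonneg _) ((abs_nonneg _).trans (hC x))

lemma G2_nu (ν : Measure ℝ) [IsFiniteMeasure ν] (p : Polynomial ℝ) :
    Integrable (fun x => G p x ^ 2) ν := by
  simpa [sq] using GG_nu ν p p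

lemma G_nu (ν : Measure ℝ) [IsFiniteMeasure ν] (p : Polynomial ℝ) : Integrable (G p) ν := by
  obtain ⟨C, hC⟩ := G_bdd p
  exact int_of_bdd (G_cont p) hC

lemma PiH_mono {a b : ℕ} (hab : a ≤ b) : PiH a ≤ PiH b :=
  Submodule.span_mono fun _ ⟨k, hk, e⟩ => ⟨k, hk.trans_le hab, e⟩

lemma int_weight (ν : Measure ℝ) [IsFiniteMeasure ν] : Integrable (fun x : ℝ => (1 + x ^ 4)⁻¹) ν := by
  refine int_of_bdd (C := 1) ?_ fun x => ?_
  · exact Continuous.inv₀ (by fun_prop) fun x => by positivity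
  · rw [abs_of_nonneg (by positivity)]
    exact inv_le_one_of_one_le₀ (by nlinarith [sq_nonneg (x ^ 2)])

lemma weight_pt (m : ℕ) (hm : 1 ≤ m) (x : ℝ) : (1 + x ^ 4)⁻¹ ≤
    16 * kap⁻¹ * (∑ i ∈ Finset.range m, (if 2 ^ i ≤ m then (1 / 4 : ℝ) ^ i * K (2 ^ i) x else 0)) +
      16 / (m : ℝ) ^ 2 := by
  have hk := kap_pos
  have hm' : (1 : ℝ) ≤ m := by exact_mod_cast hm
  have hK0 : ∀ N, 0 ≤ K N x := fun N => Finset.sum_nonneg fun k _ => sq_nonneg _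
  have hterm : ∀ i ∈ Finset.range m, 0 ≤ (if 2 ^ i ≤ m then (1 / 4 : ℝ) ^ i * K (2 ^ i) x else 0) := by
    intro i _
    split_ifs
    · exact mul_nonneg (by positivity) (hK0 _)
    · exact le_rfl
  have hsum := Finset.sum_nonneg hterm
  have hex : ∃ i : ℕ, 2 * x ^ 2 ≤ (2 : ℝ) ^ i := by
    obtain ⟨i, hi⟩ := pow_unbounded_of_one_lt (2 * x ^ 2) (by norm_num : (1 : ℝ) < 2)
    exact ⟨i, hi.le⟩
  classical
  set i := Nat.find hex with hi
  have hix := Nat.find_spec hex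
  have hlow : (4 : ℝ) ^ i ≤ 16 * (1 + x ^ 4) := by
    rcases Nat.eq_zero_or_pos i with h0 | h0
    · rw [h0]
      have : 0 ≤ x ^ 4 := by positivity
      norm_num
      linarith
    · have := Nat.find_min hex (m := i - 1) (by omega)
      rw [not_le] at this
      obtain ⟨j, hj⟩ : ∃ j, i = j + 1 := ⟨i - 1, by omega⟩
      rw [hj] at this ⊢
      simp only [Nat.add_sub_cancel] at this
      have h2 : (4 : ℝ) ^ (j + 1) = 4 * ((2 : ℝ) ^ j) ^ 2 := by
        rw [← pow_mul, mul_comm j 2, pow_mul, pow_succ]; norm_num; ring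
      rw [h2]
      have h3 : ((2 : ℝ) ^ j) ^ 2 ≤ (2 * x ^ 2) ^ 2 := by gcongr
      nlinarith
  have h4 : (4 : ℝ) ^ i > 0 := by positivity
  have hinv : (1 + x ^ 4)⁻¹ ≤ 16 * (1 / 4 : ℝ) ^ i := by
    rw [one_div, inv_pow, inv_le_comm₀ (by positivity) (by positivity), mul_inv, inv_inv]
    linarith
  by_cases hc : 2 ^ i ≤ m
  · have him : i ∈ Finset.range m := Finset.mem_range.2 (lt_of_lt_of_le Nat.lt_two_pow_self hc)
    have h5 := Finset.single_le_sum hterm him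
    simp only [hc, if_true] at h5
    have h6 := K_lower (2 ^ i) Nat.one_le_two_pow x (by push_cast; exact hix)
    have h7 : (1 / 4 : ℝ) ^ i * kap ≤ (1 / 4 : ℝ) ^ i * K (2 ^ i) x := by gcongr
    have h8 := h7.trans h5
    have h9 : 16 * kap⁻¹ * ((1 / 4 : ℝ) ^ i * kap) ≤ 16 * kap⁻¹ *
        (∑ i ∈ Finset.range m, (if 2 ^ i ≤ m then (1 / 4 : ℝ) ^ i * K (2 ^ i) x else 0)) := by gcongr
    have h10 : 16 * kap⁻¹ * ((1 / 4 : ℝ) ^ i * kap) = 16 * (1 / 4 : ℝ) ^ i := by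
      field_simp
    have : 0 ≤ 16 / (m : ℝ) ^ 2 := by positivity
    linarith
  · have h5 : (m : ℝ) ^ 2 ≤ 4 ^ i := by
      have : (m : ℝ) ≤ 2 ^ i := by exact_mod_cast (not_le.1 hc).le
      have := pow_le_pow_left₀ (by positivity) this 2
      refine this.trans_eq ?_
      rw [← pow_mul, mul_comm i 2, pow_mul]; norm_num
    have h6 : 16 * (1 / 4 : ℝ) ^ i ≤ 16 / (m : ℝ) ^ 2 := by
      rw [one_div, inv_pow, ← div_eq_mul_inv]
      gcongr
    have : 0 ≤ 16 * kap⁻¹ *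
        (∑ i ∈ Finset.range m, (if 2 ^ i ≤ m then (1 / 4 : ℝ) ^ i * K (2 ^ i) x else 0)) := by positivity
    linarith

lemma weight_int (m : ℕ) (hm : 1 ≤ m) (ν : Measure ℝ) [IsFiniteMeasure ν] (c₂ c₄ : ℝ) (h2 : 0 < c₂)
    (hup : ∀ P ∈ PiH m, ∫ x, P x ^ 2 ∂ν ≤ c₂ * ∫ x, P x ^ 2) (h4 : 0 < c₄)
    (hν : ν.real Set.univ ≤ c₄ * Real.sqrt m) :
    ∫ x, (1 + x ^ 4)⁻¹ ∂ν ≤ 32 * kap⁻¹ * c₂ + 16 * c₄ := by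
  have hk := kap_pos
  have hm' : (1 : ℝ) ≤ m := by exact_mod_cast hm
  have hKi : ∀ N, Integrable (K N) ν := fun N => by
    unfold K
    exact integrable_finsetSum _ fun k _ => G2_nu ν _
  have hKb : ∀ N ≤ m, ∫ x, K N x ∂ν ≤ c₂ * N := by
    intro N hN
    unfold K
    rw [integral_finsetSum _ fun k _ => G2_nu ν _]
    calc ∑ k ∈ Finset.range N, ∫ x, G (h k) x ^ 2 ∂ν ≤ ∑ k ∈ Finset.range N, c₂ := by
          refine Finset.sum_le_sum fun k hk => ?_
          have := hup (G (h k)) (Submodule.subset_span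
            ⟨k, (Finset.mem_range.1 hk).trans_le hN, (psi_eq k).symm⟩)
          have o := orth k k
          simp only [← sq, if_true] at o
          rwa [o, mul_one] at this
      _ = c₂ * N := by simp; ring
  have hti : ∀ i, Integrable (fun x => if 2 ^ i ≤ m then (1 / 4 : ℝ) ^ i * K (2 ^ i) x else 0) ν := by
    intro i
    split_ifs
    · exact (hKi _).const_mul _
    · exact integrable_zero _ _ _
  have hsi := integrable_finsetSum (Finset.range m) fun i _ => hti i
  have h := integral_mono (int_weight ν) ((hsi.const_mul (16 * kap⁻¹)).add (integrable_const (16 / (m : ℝ) ^ 2)))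
    (fun x => weight_pt m hm x)
  refine h.trans ?_
  simp only [Pi.add_apply]
  rw [integral_add (hsi.const_mul (16 * kap⁻¹)) (integrable_const _), integral_const_mul,
    integral_finsetSum _ fun i _ => hti i, integral_const, smul_eq_mul]
  have hA : ∑ i ∈ Finset.range m, ∫ x, (if 2 ^ i ≤ m then (1 / 4 : ℝ) ^ i * K (2 ^ i) x else 0) ∂ν ≤ c₂ * 2 := by
    calc _ ≤ ∑ i ∈ Finset.range m, c₂ * (1 / 2 : ℝ) ^ i := by
          refine Finset.sum_le_sum fun i _ => ?_
          split_ifs with hi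
          · rw [integral_const_mul]
            have := hKb _ hi
            calc (1 / 4 : ℝ) ^ i * ∫ x, K (2 ^ i) x ∂ν ≤ (1 / 4 : ℝ) ^ i * (c₂ * ((2 ^ i : ℕ) : ℝ)) := by gcongr
              _ = c₂ * (1 / 2 : ℝ) ^ i := by
                push_cast
                rw [show (1 / 2 : ℝ) = (1 / 4) * 2 by norm_num, mul_pow]
                ring
          · simp
            positivity
      _ ≤ c₂ * 2 := by
        rw [← Finset.mul_sum]
        gcongr
        exact sum_geometric_two_le m
  have hB : ν.real Set.univ * (16 / (m : ℝ) ^ 2) ≤ 16 * c₄ := by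
    have hs : Real.sqrt m ≤ m := Real.sqrt_le_iff.2 ⟨by positivity, by nlinarith⟩
    calc ν.real Set.univ * (16 / (m : ℝ) ^ 2) ≤ (c₄ * m ^ 2) * (16 / (m : ℝ) ^ 2) := by
          gcongr
          refine hν.trans ?_
          gcongr
          nlinarith
      _ = 16 * c₄ := by field_simp
  have : 16 * kap⁻¹ * (∑ i ∈ Finset.range m, ∫ x, (if 2 ^ i ≤ m then (1 / 4 : ℝ) ^ i * K (2 ^ i) x else 0) ∂ν) ≤
     16 * kap⁻¹ * (c₂ * 2) := by gcongr
  linarith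

lemma nu_l1 (m n : ℕ) (hn : 1 ≤ n) (hnm : n ≤ m) (ν : Measure ℝ) [IsFiniteMeasure ν] (c₂ c₄ : ℝ) (h2 : 0 < c₂)
    (hup : ∀ P ∈ PiH m, ∫ x, P x ^ 2 ∂ν ≤ c₂ * ∫ x, P x ^ 2) (h4 : 0 < c₄)
    (hν : ν.real Set.univ ≤ c₄ * Real.sqrt m) (a : ℕ → ℝ) :
    (∫ x, |G (pp n a) x| ∂ν) ^ 2 ≤ (9 * c₂ * (32 * kap⁻¹ * c₂ + 16 * c₄)) * n ^ 2 * ∫ x, G (pp n a) x ^ 2 := by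
  have hk := kap_pos
  have hn' : (1 : ℝ) ≤ n := by exact_mod_cast hn
  have hA : 0 ≤ ∫ x, G (pp n a) x ^ 2 := integral_nonneg fun x => sq_nonneg _
  have hQ := hup _ (PiH_mono hnm (pp_mem n a))
  by_cases hc : n + 2 ≤ m
  · obtain ⟨b, hb⟩ := X_mem n a
    obtain ⟨d, hd⟩ := X_mem (n + 1) b
    have hX := hup _ (PiH_mono hc (pp_mem (n + 2) d))
    have hpos : ∀ x : ℝ, 0 < Real.sqrt (1 + x ^ 4) := fun x => Real.sqrt_pos.2 (by positivity)
    have hsq : ∀ x : ℝ, Real.sqrt (1 + x ^ 4) ^ 2 = 1 + x ^ 4 := fun x => Real.sq_sqrt (by positivity)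
    have e1 : ∀ x : ℝ, ((Real.sqrt (1 + x ^ 4))⁻¹) ^ 2 = (1 + x ^ 4)⁻¹ := by
      intro x
      rw [inv_pow, hsq]
    have e2 : ∀ x : ℝ, (Real.sqrt (1 + x ^ 4) * |G (pp n a) x|) ^ 2 =
        G (pp n a) x ^ 2 + G (pp (n + 2) d) x ^ 2 := by
      intro x
      rw [mul_pow, hsq, sq_abs, hd, hb]
      ring
    have e3 : ∀ x : ℝ, (Real.sqrt (1 + x ^ 4))⁻¹ * (Real.sqrt (1 + x ^ 4) * |G (pp n a) x|) = |G (pp n a) x| := by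
      intro x
      rw [← mul_assoc, inv_mul_cancel₀ (hpos x).ne', one_mul]
    have := cs (μ := ν) (f := fun x => (Real.sqrt (1 + x ^ 4))⁻¹)
      (g := fun x => Real.sqrt (1 + x ^ 4) * |G (pp n a) x|) (by simpa only [e1] using int_weight ν)
      (by simp only [e2]; exact (G2_nu ν (pp n a)).add (G2_nu ν (pp (n + 2) d)))
      (by simpa only [e3] using (G_nu ν (pp n a)).abs)
    simp only [e1, e2, e3] at this
    rw [integral_add (G2_nu ν _) (G2_nu ν _)] at this
    have hW := weight_int m (hn.trans hnm) ν c₂ c₄ h2 hup h4 hν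
    have m1 := moment n a
    have m2 := moment (n + 1) b
    have m1' : 0 ≤ ∫ x, G (Polynomial.derivative (pp n a) - Polynomial.X * pp n a) x ^ 2 :=
      integral_nonneg fun x => sq_nonneg _
    have m2' : 0 ≤ ∫ x, G (Polynomial.derivative (pp (n + 1) b) - Polynomial.X * pp (n + 1) b) x ^ 2 :=
      integral_nonneg fun x => sq_nonneg _
    simp only [G_X, ← hb] at m1
    simp only [G_X, ← hd] at m2
    push_cast at m2
    have m3 : (∫ x, G (pp (n + 2) d) x ^ 2) ≤ 8 * n ^ 2 * ∫ x, G (pp n a) x ^ 2 := by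
      calc (∫ x, G (pp (n + 2) d) x ^ 2) ≤ 2 * (n + 1) * ∫ x, G (pp (n + 1) b) x ^ 2 := by
            simpa using (by linarith : (∫ x, G (pp (n + 1 + 1) d) x ^ 2) ≤ 2 * ((n : ℝ) + 1) * ∫ x, G (pp (n + 1) b) x ^ 2)
        _ ≤ 2 * (n + n) * (2 * n * ∫ x, G (pp n a) x ^ 2) := by
          gcongr
          linarith
        _ = _ := by ring
    have m4 : (∫ x, G (pp n a) x ^ 2 ∂ν) + ∫ x, G (pp (n + 2) d) x ^ 2 ∂ν ≤
        c₂ * (9 * n ^ 2 * ∫ x, G (pp n a) x ^ 2) := by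
      have : (∫ x, G (pp n a) x ^ 2) + (∫ x, G (pp (n + 2) d) x ^ 2) ≤ 9 * n ^ 2 * ∫ x, G (pp n a) x ^ 2 := by
        have h1 : 1 * (∫ x, G (pp n a) x ^ 2) ≤ (n : ℝ) ^ 2 * ∫ x, G (pp n a) x ^ 2 :=
          mul_le_mul_of_nonneg_right (by nlinarith) hA
        linarith
      have := mul_le_mul_of_nonneg_left this h2.le
      linarith
    refine this.trans ?_
    calc _ ≤ (32 * kap⁻¹ * c₂ + 16 * c₄) * (c₂ * (9 * n ^ 2 * ∫ x, G (pp n a) x ^ 2)) := by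
          refine mul_le_mul hW m4 ?_ (by positivity)
          exact add_nonneg (integral_nonneg fun x => sq_nonneg _) (integral_nonneg fun x => sq_nonneg _)
      _ = _ := by ring
  · have := cs (μ := ν) (f := fun x => (1 : ℝ)) (g := fun x => |G (pp n a) x|)
      (by simp) (by simpa using G2_nu ν (pp n a)) (by simpa using (G_nu ν (pp n a)).abs)
    simp at this
    have hs : Real.sqrt m ≤ 2 * n ^ 2 := by
      have h1 : (m : ℝ) ≤ n + 1 := by exact_mod_cast (by omega : m ≤ n + 1)
      have hm' : (1 : ℝ) ≤ m := by exact_mod_cast hn.trans hnm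
      have : Real.sqrt m ≤ m := Real.sqrt_le_iff.2 ⟨by positivity, by nlinarith⟩
      nlinarith
    refine this.trans ?_
    calc _ ≤ (c₄ * (2 * n ^ 2)) * (c₂ * ∫ x, G (pp n a) x ^ 2) := by
          refine mul_le_mul (hν.trans ?_) hQ (integral_nonneg fun x => sq_nonneg _) (by positivity)
          gcongr
      _ = (2 * c₂ * c₄) * n ^ 2 * ∫ x, G (pp n a) x ^ 2 := by ring
      _ ≤ _ := by
        gcongr ?_ * _ * _
        have : 0 < kap⁻¹ * c₂ ^ 2 := by positivity
        have : 0 < c₂ * c₄ := by positivity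
        nlinarith

end HermAux
namespace HermAux

lemma proj_bound (m n : ℕ) (hn : 1 ≤ n) (hnm : n ≤ m) (ν : Measure ℝ) [IsFiniteMeasure ν] (c₁ c₂ c₄ : ℝ)
    (h1 : 0 < c₁) (h2 : 0 < c₂)
    (hlow : ∀ P ∈ PiH m, c₁ * ∫ x, P x ^ 2 ≤ ∫ x, P x ^ 2 ∂ν)
    (hup : ∀ P ∈ PiH m, ∫ x, P x ^ 2 ∂ν ≤ c₂ * ∫ x, P x ^ 2) (h4 : 0 < c₄)
    (hν : ν.real Set.univ ≤ c₄ * Real.sqrt m) (a : ℕ → ℝ) (g : ℝ → ℝ) (hg : Continuous g) (M : ℝ)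
    (hM : ∀ x, |g x| ≤ M)
    (hmin : ∀ t : ℝ, ∫ x, (g x - G (pp n a) x) ^ 2 ∂ν ≤ ∫ x, (g x - t * G (pp n a) x) ^ 2 ∂ν) :
    ∫ x, |G (pp n a) x| ≤
      Real.sqrt (3 * Real.pi * (9 * c₂ * (32 * kap⁻¹ * c₂ + 16 * c₄)) / c₁ ^ 2) *
        (n : ℝ) ^ ((3 : ℝ) / 2) * M := by
  have hk := kap_pos
  have hM0 : 0 ≤ M := (abs_nonneg _).trans (hM 0)
  have hn' : (1 : ℝ) ≤ n := by exact_mod_cast hn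
  set Q := G (pp n a) with hQ
  have hQc : Continuous Q := G_cont _
  obtain ⟨C, hC⟩ := G_bdd (pp n a)
  have iQ2 : Integrable (fun x => Q x ^ 2) ν := G2_nu ν _
  have igQ : Integrable (fun x => g x * Q x) ν := by
    refine int_of_bdd (hg.mul hQc) (C := M * C) fun x => ?_
    rw [abs_mul]
    exact mul_le_mul (hM x) (hC x) (abs_nonneg _) hM0
  have ig2 : Integrable (fun x => g x ^ 2) ν := by
    refine int_of_bdd (hg.pow 2) (C := M ^ 2) fun x => ?_
    rw [abs_pow]
    exact pow_le_pow_left₀ (abs_nonneg _) (hM x) 2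
  set A := ∫ x, Q x ^ 2 ∂ν with hA
  set B := ∫ x, g x * Q x ∂ν with hB
  have hexp : ∀ t : ℝ, ∫ x, (g x - t * Q x) ^ 2 ∂ν = (∫ x, g x ^ 2 ∂ν) + (-2 * t * B + t ^ 2 * A) := by
    intro t
    have e : ∀ x, (g x - t * Q x) ^ 2 = g x ^ 2 + (-2 * t * (g x * Q x) + t ^ 2 * Q x ^ 2) := by
      intro x; ring
    have i1 : Integrable (fun x => -2 * t * (g x * Q x) + t ^ 2 * Q x ^ 2) ν :=
      (igQ.const_mul _).add (iQ2.const_mul _)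
    simp only [e]
    rw [integral_add ig2 i1, integral_add (igQ.const_mul _) (iQ2.const_mul _), integral_const_mul,
      integral_const_mul]
  have h10 := hexp 1
  simp only [one_mul] at h10
  have hAB : A = B := by
    have : ∀ u : ℝ, 0 ≤ A * (u * u) + (2 * (A - B)) * u + 0 := by
      intro u
      have := hmin (1 + u)
      rw [h10, hexp] at this
      nlinarith
    have := discrim_le_zero this
    unfold discrim at this
    nlinarith [sq_nonneg (A - B)]
  have hBM : B ≤ M * ∫ x, |Q x| ∂ν := by
    rw [← integral_const_mul]
    refine integral_mono igQ ((G_nu ν (pp n a)).abs.const_mul _) fun x => ?_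
    simp only
    refine (le_abs_self _).trans ?_
    rw [abs_mul]
    exact mul_le_mul_of_nonneg_right (hM x) (abs_nonneg _)
  have hL := nu_l1 m n hn hnm ν c₂ c₄ h2 hup h4 hν a
  have hlo := hlow Q (PiH_mono hnm (pp_mem n a))
  have hl1 := l1_bound n hn a
  simp only [← hQ] at hL hl1
  set D := 9 * c₂ * (32 * kap⁻¹ * c₂ + 16 * c₄) with hD
  have hD0 : 0 < D := by positivity
  set E := ∫ x, Q x ^ 2 with hE
  have hE0 : 0 ≤ E := integral_nonneg fun x => sq_nonneg _
  have s1 : c₁ * E ≤ M * ∫ x, |Q x| ∂ν := by linarith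
  have s2 : (c₁ * E) ^ 2 ≤ M ^ 2 * (D * n ^ 2 * E) := by
    calc (c₁ * E) ^ 2 ≤ (M * ∫ x, |Q x| ∂ν) ^ 2 := pow_le_pow_left₀ (by positivity) s1 2
      _ = M ^ 2 * (∫ x, |Q x| ∂ν) ^ 2 := by ring
      _ ≤ _ := by gcongr
  have s3 : c₁ ^ 2 * E ≤ M ^ 2 * (D * n ^ 2) := by
    rcases hE0.eq_or_lt with h0 | h0
    · rw [← h0]; simp; positivity
    · have : E * (c₁ ^ 2 * E) ≤ E * (M ^ 2 * (D * n ^ 2)) := by nlinarith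
      exact le_of_mul_le_mul_left this h0
  have s4 : E ≤ M ^ 2 * (D * n ^ 2) / c₁ ^ 2 := by
    rw [le_div_iff₀ (by positivity)]
    linarith
  have hpi := Real.pi_pos
  have hn3 : ((n : ℝ) ^ ((3 : ℝ) / 2)) ^ 2 = (n : ℝ) ^ 3 := by
    rw [← Real.rpow_natCast ((n : ℝ) ^ ((3 : ℝ) / 2)), ← Real.rpow_mul (by positivity)]
    norm_num
  refine (pow_le_pow_iff_left₀ (integral_nonneg fun x => abs_nonneg _) (by positivity) (two_ne_zero)).1 ?_
  rw [mul_pow, mul_pow, Real.sq_sqrt (by positivity), hn3]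
  calc _ ≤ 3 * Real.pi * n * E := hl1
    _ ≤ 3 * Real.pi * n * (M ^ 2 * (D * n ^ 2) / c₁ ^ 2) := by gcongr
    _ = _ := by ring

lemma eL1 {g : ℝ → ℝ} (hg : Integrable g) : eLpNorm g 1 volume = ENNReal.ofReal (∫ x, |g x|) := by
  rw [eLpNorm_one_eq_lintegral_enorm, ← ofReal_integral_norm_eq_lintegral_enorm hg]
  rfl

lemma sup_pt {g : ℝ → ℝ} (hg : Continuous g) (hfin : eLpNorm g ⊤ volume ≠ ⊤) (x : ℝ) :
    |g x| ≤ (eLpNorm g ⊤ volume).toReal := by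
  set M := (eLpNorm g ⊤ volume).toReal with hM
  have hae : ∀ᵐ x, |g x| ≤ M := by
    have h0 := enorm_ae_le_eLpNormEssSup g volume
    filter_upwards [h0] with x hx
    rw [← eLpNorm_exponent_top] at hx
    have := ENNReal.toReal_mono hfin hx
    rw [toReal_enorm, Real.norm_eq_abs] at this
    exact this
  have ho : IsOpen {x | M < |g x|} := isOpen_lt continuous_const hg.abs
  have hz : volume {x | M < |g x|} = 0 := by
    rw [ae_iff] at hae
    simpa using hae
  have he := (ho.measure_eq_zero_iff volume).1 hz
  by_contra hc
  have : x ∈ {x | M < |g x|} := not_le.1 hc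
  rw [he] at this
  exact this

lemma fourier_bound {f Sf : ℝ → ℝ} (hf : Integrable f) (hS : Integrable Sf) (ω : ℝ) :
    (‖fourierT f ω - fourierT Sf ω‖₊ : ℝ≥0∞) ≤ eLpNorm (fun t => f t - Sf t) 1 volume := by
  have hexp : ∀ t : ℝ, ‖Complex.exp (-(Complex.I * ω * t))‖ = 1 := by
    intro t
    rw [Complex.norm_exp]
    simp
  have key : ∀ g : ℝ → ℝ, Integrable g →
      Integrable (fun t : ℝ => (g t : ℂ) * Complex.exp (-(Complex.I * ω * t))) := by
    intro g hg
    refine hg.ofReal.mul_bdd (c := 1) ?_ (ae_of_all _ fun t => (hexp t).le)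
    exact (by fun_prop : Continuous fun t : ℝ => Complex.exp (-(Complex.I * ω * t))).aestronglyMeasurable
  have hd : Integrable (fun t => f t - Sf t) := hf.sub hS
  rw [eL1 hd]
  unfold fourierT
  rw [← mul_sub, ← integral_sub (key f hf) (key Sf hS)]
  rw [← enorm_eq_nnnorm, ← ofReal_norm]
  apply ENNReal.ofReal_le_ofReal
  rw [norm_mul]
  have h1 : ‖((Real.sqrt (2 * Real.pi) : ℂ))⁻¹‖ ≤ 1 := by
    rw [norm_inv, Complex.norm_real, Real.norm_of_nonneg (Real.sqrt_nonneg _)]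
    apply inv_le_one_of_one_le₀
    rw [Real.one_le_sqrt]
    linarith [Real.pi_gt_three]
  have h2 : ‖∫ t : ℝ, ((f t : ℂ) * Complex.exp (-(Complex.I * ω * t)) -
      (Sf t : ℂ) * Complex.exp (-(Complex.I * ω * t)))‖ ≤ ∫ t, |f t - Sf t| := by
    refine (norm_integral_le_integral_norm _).trans_eq ?_
    congr 1
    funext t
    rw [← sub_mul, norm_mul, hexp, mul_one, ← Complex.ofReal_sub, Complex.norm_real]
    rfl
  calc _ ≤ 1 * ∫ t, |f t - Sf t| := mul_le_mul h1 h2 (norm_nonneg _) zero_le_one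
    _ = _ := one_mul _

lemma lint_eq {μ : Measure ℝ} {P : ℝ → ℝ} (hP : Integrable (fun x => P x ^ 2) μ) :
    ∫⁻ t, ENNReal.ofReal (P t ^ 2) ∂μ = ENNReal.ofReal (∫ t, P t ^ 2 ∂μ) :=
  (ofReal_integral_eq_lintegral_ofReal hP (ae_of_all _ fun x => sq_nonneg _)).symm

end HermAux

open HermAux
theorem stmt3 (c₁ c₂ c₃ c₄ : ℝ) (h₁ : 0 < c₁) (h₂ : 0 < c₂) (h₃ : 0 < c₃) (h₄ : 0 < c₄) :
    ∃ c : ℝ, 0 < c ∧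
      ∀ (f : ℝ → ℝ), Continuous f → Tendsto f (cocompact ℝ) (nhds 0) → Integrable f volume →
      ∀ (m n : ℕ), 1 ≤ n → n ≤ m →
      ∀ (ν : Measure ℝ), SMZ m c₁ c₂ c₃ c₄ ν →
      ∀ Sf : ℝ → ℝ, Sf ∈ PiH n →
        (∀ P ∈ PiH n,
          (∫⁻ t, ENNReal.ofReal ((f t - Sf t) ^ 2) ∂ν) ≤ ∫⁻ t, ENNReal.ofReal ((f t - P t) ^ 2) ∂ν) →
        (⨆ ω : ℝ, (‖fourierT f ω - fourierT Sf ω‖₊ : ℝ≥0∞)) ≤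
            ENNReal.ofReal c * eLpNorm (fun t => f t - Sf t) 1 volume ∧
          eLpNorm (fun t => f t - Sf t) 1 volume ≤
            ENNReal.ofReal c * (ENNReal.ofReal (Real.sqrt n) * degApproxH 1 n f +
              ENNReal.ofReal ((n : ℝ) ^ ((3 : ℝ) / 2)) * degApproxH ⊤ n f) := by
  set C8 := Real.sqrt (3 * Real.pi * (9 * c₂ * (32 * kap⁻¹ * c₂ + 16 * c₄)) / c₁ ^ 2) with hC8
  have hC80 : 0 ≤ C8 := Real.sqrt_nonneg _
  refine ⟨88 + C8, by positivity, ?_⟩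
  intro f hfc _ hfi m n hn hnm ν hSMZ Sf hSf hmin
  obtain ⟨hMZ, -, hνu⟩ := hSMZ
  have hn' : (1 : ℝ) ≤ n := by exact_mod_cast hn
  have : IsFiniteMeasure ν := ⟨hνu.trans_lt ENNReal.ofReal_lt_top⟩
  have hνr : ν.real Set.univ ≤ c₄ * Real.sqrt m :=
    ENNReal.toReal_le_of_le_ofReal (by positivity) hνu
  have hPint : ∀ k, ∀ P ∈ PiH k, Integrable P ∧ Continuous P := by
    intro k P hP
    obtain ⟨a, rfl⟩ := mem_pp hP
    exact ⟨G_int _, G_cont _⟩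
  have hlow : ∀ P ∈ PiH m, c₁ * ∫ x, P x ^ 2 ≤ ∫ x, P x ^ 2 ∂ν := by
    intro P hP
    have h := (hMZ P hP).1
    obtain ⟨a, rfl⟩ := mem_pp hP
    rw [lint_eq (G2_int _), lint_eq (G2_nu ν _), ← ENNReal.ofReal_mul h₁.le] at h
    exact (ENNReal.ofReal_le_ofReal_iff (integral_nonneg fun x => sq_nonneg _)).1 h
  have hup : ∀ P ∈ PiH m, ∫ x, P x ^ 2 ∂ν ≤ c₂ * ∫ x, P x ^ 2 := by
    intro P hP
    have h := (hMZ P hP).2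
    obtain ⟨a, rfl⟩ := mem_pp hP
    rw [lint_eq (G2_int _), lint_eq (G2_nu ν _), ← ENNReal.ofReal_mul h₂.le] at h
    exact (ENNReal.ofReal_le_ofReal_iff
      (mul_nonneg h₂.le (integral_nonneg fun x => sq_nonneg _))).1 h
  constructor
  · refine iSup_le fun ω => (fourier_bound hfi (hPint n _ hSf).1 ω).trans ?_
    refine le_mul_of_one_le_left (zero_le) ?_
    rw [← ENNReal.ofReal_one]
    exact ENNReal.ofReal_le_ofReal (by linarith)
  · -- main estimate for an arbitrary pair
    have key : ∀ P₁ ∈ PiH n, ∀ P₂ ∈ PiH n, eLpNorm (fun t => f t - Sf t) 1 volume ≤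
        ENNReal.ofReal (88 + C8) * (ENNReal.ofReal (Real.sqrt n) * eLpNorm (fun x => f x - P₁ x) 1 volume +
          ENNReal.ofReal ((n : ℝ) ^ ((3 : ℝ) / 2)) * eLpNorm (fun x => f x - P₂ x) ⊤ volume) := by
      intro P₁ hP₁ P₂ hP₂
      have hn32 : 0 < (n : ℝ) ^ ((3 : ℝ) / 2) := by positivity
      by_cases htop : eLpNorm (fun x => f x - P₂ x) ⊤ volume = ⊤
      · rw [htop, ENNReal.mul_top (by simpa using hn32), add_top, ENNReal.mul_top]
        · exact le_top
        · simp; positivity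
      set M := (eLpNorm (fun x => f x - P₂ x) ⊤ volume).toReal with hM
      have hgc : Continuous (fun x => f x - P₂ x) := hfc.sub (hPint n _ hP₂).2
      have hMp : ∀ x, |f x - P₂ x| ≤ M := fun x => sup_pt hgc htop x
      have hM0 : 0 ≤ M := ENNReal.toReal_nonneg
      obtain ⟨a, ha⟩ := mem_pp (Submodule.sub_mem _ hSf hP₂)
      obtain ⟨b, hb⟩ := mem_pp (Submodule.sub_mem _ hP₁ hP₂)
      have ha' : ∀ x, Sf x - P₂ x = G (pp n a) x := fun x => congrFun ha x
      have hb' : ∀ x, P₁ x - P₂ x = G (pp n b) x := fun x => congrFun hb x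
      obtain ⟨Ca, hCa⟩ := G_bdd (pp n a)
      have hminr : ∀ t : ℝ, ∫ x, ((f x - P₂ x) - G (pp n a) x) ^ 2 ∂ν ≤
          ∫ x, ((f x - P₂ x) - t * G (pp n a) x) ^ 2 ∂ν := by
        intro t
        have hi : ∀ t : ℝ, Integrable (fun x => ((f x - P₂ x) - t * G (pp n a) x) ^ 2) ν := by
          intro t
          refine int_of_bdd ((hgc.sub ((G_cont _).const_mul t)).pow 2) (C := (M + |t| * Ca) ^ 2) fun x => ?_
          rw [abs_pow]
          refine pow_le_pow_left₀ (abs_nonneg _) ?_ 2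
          refine (abs_sub _ _).trans ?_
          rw [abs_mul]
          have := hMp x
          have := hCa x
          gcongr
        have h := hmin (P₂ + t • G (pp n a))
          (Submodule.add_mem _ hP₂ (Submodule.smul_mem _ _ (pp_mem n a)))
        have e1 : ∀ x, f x - Sf x = (f x - P₂ x) - 1 * G (pp n a) x := by
          intro x; rw [← ha']; ring
        have e2 : ∀ x, f x - (P₂ + t • G (pp n a)) x = (f x - P₂ x) - t * G (pp n a) x := by
          intro x; simp; ring
        simp only [e1, e2] at h
        rw [lint_eq (hi 1), lint_eq (hi t)] at h
        have h := (ENNReal.ofReal_le_ofReal_iff (integral_nonneg fun x => sq_nonneg _)).1 h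
        simpa only [one_mul] using h
      have hproj := proj_bound m n hn hnm ν c₁ c₂ c₄ h₁ h₂ hlow hup h₄ hνr a _ hgc M hMp hminr
      rw [← hC8] at hproj
      set R := 22 * (n : ℝ) ^ ((3 : ℝ) / 2) with hR
      have hrange := range_ineq n hn b R hR
      have hd1 : Integrable (fun x => f x - P₁ x) := hfi.sub (hPint n _ hP₁).1
      have hloc : ∫ x in Set.Icc (-R) R, |G (pp n b) x| ≤ (∫ x, |f x - P₁ x|) + 2 * R * M := by
        have hcst : IntegrableOn (fun _ : ℝ => M) (Set.Icc (-R) R) := by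
          simp
        calc ∫ x in Set.Icc (-R) R, |G (pp n b) x| ≤ ∫ x in Set.Icc (-R) R, (|f x - P₁ x| + M) := by
              refine integral_mono (G_int _).abs.integrableOn (hd1.abs.integrableOn.add hcst) fun x => ?_
              simp only
              rw [← hb']
              have e : P₁ x - P₂ x = (f x - P₂ x) - (f x - P₁ x) := by ring
              rw [e]
              have := abs_sub (f x - P₂ x) (f x - P₁ x)
              have := hMp x
              linarith
          _ = (∫ x in Set.Icc (-R) R, |f x - P₁ x|) + ∫ x in Set.Icc (-R) R, M :=
              integral_add hd1.abs.integrableOn hcst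
          _ ≤ _ := by
            have h1 := setIntegral_le_integral (s := Set.Icc (-R) R) hd1.abs
              (ae_of_all _ fun x => abs_nonneg _)
            have hR0 : 0 ≤ R := by positivity
            have h2 : ∫ x in Set.Icc (-R) R, M = 2 * R * M := by
              rw [setIntegral_const, Measure.real, Real.volume_Icc, ENNReal.toReal_ofReal (by linarith)]
              simp; left; ring
            rw [h2]
            linarith
      have htri : ∫ x, |f x - Sf x| ≤ (∫ x, |f x - P₁ x|) + ((∫ x, |G (pp n b) x|) + ∫ x, |G (pp n a) x|) := by
        have i2 : Integrable (fun x => |G (pp n b) x| + |G (pp n a) x|) := (G_int _).abs.add (G_int _).abs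
        rw [← integral_add (G_int _).abs (G_int _).abs, ← integral_add hd1.abs i2]
        refine integral_mono (hfi.sub (hPint n _ hSf).1).abs (hd1.abs.add i2) fun x => ?_
        simp only
        rw [← ha', ← hb']
        have e : f x - Sf x = (f x - P₁ x) + ((P₁ x - P₂ x) - (Sf x - P₂ x)) := by ring
        rw [e]
        have h1 := abs_add_le (f x - P₁ x) ((P₁ x - P₂ x) - (Sf x - P₂ x))
        have h2 := abs_sub (P₁ x - P₂ x) (Sf x - P₂ x)
        linarith
      have hd2 : Integrable (fun t => f t - Sf t) := hfi.sub (hPint n _ hSf).1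
      rw [eL1 hd2, eL1 hd1, ← ENNReal.ofReal_toReal htop, ← hM,
        ← ENNReal.ofReal_mul (Real.sqrt_nonneg _), ← ENNReal.ofReal_mul hn32.le,
        ← ENNReal.ofReal_add (mul_nonneg (Real.sqrt_nonneg _) (integral_nonneg fun x => abs_nonneg _))
          (mul_nonneg hn32.le hM0), ← ENNReal.ofReal_mul (by positivity)]
      apply ENNReal.ofReal_le_ofReal
      have hI : 0 ≤ ∫ x, |f x - P₁ x| := integral_nonneg fun x => abs_nonneg _
      have hsn : 1 ≤ Real.sqrt n := Real.one_le_sqrt.2 hn'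
      have hI2 : ∫ x, |f x - P₁ x| ≤ Real.sqrt n * ∫ x, |f x - P₁ x| := le_mul_of_one_le_left hI hsn
      have hCI : 0 ≤ C8 * (Real.sqrt n * ∫ x, |f x - P₁ x|) := by positivity
      have hRM : R * M = 22 * ((n : ℝ) ^ ((3 : ℝ) / 2) * M) := by rw [hR]; ring
      nlinarith
    unfold degApproxH
    simp only [iInf_subtype']
    have ha0 : ENNReal.ofReal (Real.sqrt n) ≠ 0 := by
      simp; omega
    have hb0 : ENNReal.ofReal ((n : ℝ) ^ ((3 : ℝ) / 2)) ≠ 0 := by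
      have : 0 < (n : ℝ) ^ ((3 : ℝ) / 2) := by positivity
      simpa using this
    have hc0 : ENNReal.ofReal (88 + C8) ≠ 0 := by
      simp; positivity
    rw [ENNReal.mul_iInf_of_ne ha0 ENNReal.ofReal_ne_top, ENNReal.mul_iInf_of_ne hb0 ENNReal.ofReal_ne_top,
      ENNReal.iInf_add, ENNReal.mul_iInf_of_ne hc0 ENNReal.ofReal_ne_top]
    refine le_iInf fun P₁ => ?_
    rw [ENNReal.add_iInf, ENNReal.mul_iInf_of_ne hc0 ENNReal.ofReal_ne_top]
    exact le_iInf fun P₂ => key P₁.1 P₁.2 P₂.1 P₂.2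
end

section
/- There exists a constant c > 0 such that for every integer n ≥ 1 and every x ∈ ℝ, the Christoffel-type sum satisfies K_n(x,x) = Σ_{j=0}^{n−1} ψ_j(x)² ≤ c · n^{1/2}. -/
open MeasureTheory Filter ENNReal ProbabilityTheory

open Polynomial in
/-- Physicists' Hermite polynomials. -/
noncomputable def hP : ℕ → Polynomial ℝ
  | 0 => 1
  | (k+1) => 2 * X * hP k - derivative (hP k)

open Polynomial in
lemma hP_deriv (k : ℕ) : derivative (hP (k+1)) = (2 * ((k:ℝ[X]) + 1)) * hP k := by
  induction k with
  | zero => simp [hP]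
  | succ k ih =>
    have h1 : hP (k+2) = 2 * X * hP (k+1) - derivative (hP (k+1)) := rfl
    have h2 : hP (k+1) = 2 * X * hP k - derivative (hP k) := rfl
    have h3 : derivative (derivative (hP (k+1))) = (2 * ((k:ℝ[X]) + 1)) * derivative (hP k) := by
      rw [ih]
      have : derivative (2 * ((k:ℝ[X]) + 1)) = 0 := by simp
      rw [derivative_mul, this]; ring
    rw [h1, derivative_sub, h3, derivative_mul, ih]
    have : derivative (2 * X : ℝ[X]) = 2 := by simp
    rw [this]
    push_cast
    linear_combination (-2 * ((k:ℝ[X]) + 1)) * h2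

lemma poly_gauss_hasDerivAt (p : Polynomial ℝ) (x : ℝ) :
    HasDerivAt (fun x => p.eval x * Real.exp (-x^2))
      ((Polynomial.derivative p - 2 * Polynomial.X * p).eval x * Real.exp (-x^2)) x := by
  have h1 := p.hasDerivAt x
  have h2 : HasDerivAt (fun x : ℝ => Real.exp (-x^2)) (Real.exp (-x^2) * (-(2 * x))) x := by
    have := ((hasDerivAt_pow 2 x).neg).exp
    simpa using this
  refine (h1.mul h2).congr_deriv ?_
  simp
  ring

lemma poly_gauss_integrable (p : Polynomial ℝ) :
    Integrable (fun x => p.eval x * Real.exp (-x^2)) := by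
  induction p using Polynomial.induction_on' with
  | add p q hp hq =>
    refine (hp.add hq).congr (Eventually.of_forall fun x => ?_)
    simp [add_mul]
  | monomial n a =>
    have h := (integrable_rpow_mul_exp_neg_mul_sq (b := 1) one_pos (s := (n:ℝ))
      (by have : (0:ℝ) ≤ n := n.cast_nonneg
          linarith)).const_mul a
    refine h.congr (Eventually.of_forall fun x => ?_)
    simp [mul_assoc]

lemma iter_gauss (k : ℕ) : iteratedDeriv k (fun t : ℝ => Real.exp (-t ^ 2)) =
    fun x => (-1)^k * ((hP k).eval x * Real.exp (-x^2)) := by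
  induction k with
  | zero => simp [hP]
  | succ k ih =>
    rw [iteratedDeriv_succ, ih]
    funext x
    rw [((poly_gauss_hasDerivAt (hP k) x).const_mul _).deriv]
    simp [hP, pow_succ]
    ring

noncomputable def nH (k : ℕ) : ℝ := Real.sqrt Real.pi * 2 ^ k * (Nat.factorial k : ℝ)

lemma nH_pos (k : ℕ) : 0 < nH k := by
  unfold nH
  have := Real.pi_pos
  positivity

lemma nH_succ (k : ℕ) : nH (k+1) = 2 * (k+1) * nH k := by
  unfold nH
  rw [Nat.factorial_succ]
  push_cast
  ring

lemma psiH_sq (k : ℕ) (x : ℝ) :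
    psiH k x ^ 2 = (hP k ^ 2).eval x * Real.exp (-x^2) / nH k := by
  unfold psiH
  rw [iter_gauss]
  change (nH k ^ (-(1 : ℝ) / 2) * _ * _ * _)^2 = _
  have h1 : (nH k ^ (-(1 : ℝ) / 2))^2 = (nH k)⁻¹ := by
    rw [← Real.rpow_natCast, ← Real.rpow_mul (nH_pos k).le, ← Real.rpow_neg_one]
    norm_num
  have h2 : (((-1:ℝ)^k))^2 = 1 := by rw [← pow_mul, mul_comm, pow_mul]; norm_num
  have h3 : Real.exp (x^2/2)^2 * Real.exp (-x^2) = 1 := by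
    rw [← Real.exp_nat_mul, ← Real.exp_add]; simp; ring
  simp only [mul_pow, h1, h2, Polynomial.eval_pow]
  rw [div_eq_mul_inv]
  have h4 : Real.exp (x ^ 2 / 2) = Real.exp (x ^ 2 * 2⁻¹) := by rw [div_eq_mul_inv]
  rw [h4] at h3
  try rw [h4]
  linear_combination ((nH k)⁻¹ * (hP k).eval x ^ 2 * Real.exp (-x^2)) * h3

lemma hP_norm (k : ℕ) : ∫ x, (hP k ^ 2).eval x * Real.exp (-x^2) = nH k := by
  induction k with
  | zero =>
    have := integral_gaussian 1
    simpa [hP, nH] using this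
  | succ k ih =>
    have h := integral_eq_zero_of_hasDerivAt_of_integrable
      (fun x => poly_gauss_hasDerivAt (hP k * hP (k+1)) x)
      (poly_gauss_integrable _) (poly_gauss_integrable _)
    have e : Polynomial.derivative (hP k * hP (k+1)) - 2 * Polynomial.X * (hP k * hP (k+1))
        = (2 * ((k:Polynomial ℝ) + 1)) * hP k ^ 2 - hP (k+1)^2 := by
      have h2 : hP (k+1) = 2 * Polynomial.X * hP k - Polynomial.derivative (hP k) := rfl
      rw [Polynomial.derivative_mul, hP_deriv]
      linear_combination (hP (k+1)) * h2
    rw [e] at h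
    have e2 : ∀ x : ℝ, ((2 * ((k:Polynomial ℝ) + 1)) * hP k ^ 2 - hP (k+1)^2).eval x
        * Real.exp (-x^2) = (2 * (k+1)) * ((hP k ^ 2).eval x * Real.exp (-x^2))
          - (hP (k+1) ^ 2).eval x * Real.exp (-x^2) := by
      intro x; simp; ring
    simp_rw [e2] at h
    rw [integral_sub ((poly_gauss_integrable _).const_mul _) (poly_gauss_integrable _),
      integral_const_mul, ih] at h
    rw [nH_succ]; linarith

/-- The polynomial part of the Christoffel sum. -/
noncomputable def fP (n : ℕ) : Polynomial ℝ :=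
  ∑ j ∈ Finset.range n, Polynomial.C (nH j)⁻¹ * hP j ^ 2

lemma sum_eq (n : ℕ) (x : ℝ) : ∑ j ∈ Finset.range n, psiH j x ^ 2 =
    (fP n).eval x * Real.exp (-x^2) := by
  simp only [fP, Polynomial.eval_finsetSum, Finset.sum_mul, psiH_sq]
  refine Finset.sum_congr rfl fun j _ => ?_
  simp
  ring

lemma fP_deriv (n : ℕ) : Polynomial.derivative (fP (n+1)) - 2 * Polynomial.X * fP (n+1) =
    - (Polynomial.C (nH n)⁻¹ * hP n * hP (n+1)) := by
  induction n with
  | zero => simp [fP, hP]; ring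
  | succ n ih =>
    have h0 : fP (n+2) = fP (n+1) + Polynomial.C (nH (n+1))⁻¹ * hP (n+1) ^ 2 := by
      simp only [fP, Finset.sum_range_succ]
    have h1 : hP (n+2) = 2 * Polynomial.X * hP (n+1) - Polynomial.derivative (hP (n+1)) := rfl
    have hd := hP_deriv n
    have hc : Polynomial.C (nH n)⁻¹ = 2 * ((n : Polynomial ℝ) + 1) * Polynomial.C (nH (n+1))⁻¹ := by
      have : (nH n)⁻¹ = 2 * ((n:ℝ)+1) * (nH (n+1))⁻¹ := by
        rw [nH_succ]
        have := (nH_pos n).ne'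
        have : (n:ℝ)+1 ≠ 0 := by positivity
        field_simp
      rw [this, Polynomial.C_mul, Polynomial.C_mul]; simp [Polynomial.C_ofNat]
    rw [hc] at ih
    rw [h0, Polynomial.derivative_add, Polynomial.derivative_mul, Polynomial.derivative_C,
      Polynomial.derivative_pow, h1]
    simp only [Nat.cast_ofNat, Polynomial.C_ofNat]
    norm_num
    linear_combination ih + Polynomial.C (nH (n+1))⁻¹ * hP (n+1) * hd

lemma main_bound (n : ℕ) (x : ℝ) :
    (fP (n+1)).eval x * Real.exp (-x^2) ≤ Real.sqrt (2 * (n+1)) := by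
  set s := Real.sqrt (2 * ((n:ℝ)+1)) with hs
  have hs0 : 0 < s := Real.sqrt_pos.2 (by positivity)
  have hs2 : s^2 = 2 * ((n:ℝ)+1) := Real.sq_sqrt (by positivity)
  have hN := nH_pos n
  have hd := fun y => poly_gauss_hasDerivAt (fP (n+1)) y
  rw [fP_deriv] at hd
  have hi := poly_gauss_integrable (fP (n+1))
  have hi' := poly_gauss_integrable (- (Polynomial.C (nH n)⁻¹ * hP n * hP (n+1)))
  have ht := tendsto_zero_of_hasDerivAt_of_integrableOn_Ioi (a := x) (fun y _ => hd y)
    hi'.integrableOn hi.integrableOn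
  have hF := integral_Ioi_of_hasDerivAt_of_tendsto' (a := x) (fun y _ => hd y)
    hi'.integrableOn ht
  let G : ℝ → ℝ := fun y => (s / (2 * nH n)) * ((hP n ^ 2).eval y * Real.exp (-y^2))
    + (1 / (2 * s * nH n)) * ((hP (n+1) ^ 2).eval y * Real.exp (-y^2))
  have hG : Integrable G :=
    ((poly_gauss_integrable _).const_mul _).add ((poly_gauss_integrable _).const_mul _)
  have hG0 : ∀ y, 0 ≤ G y := by
    intro y
    simp only [G, Polynomial.eval_pow]
    positivity
  have hGi : ∫ y, G y = s := by
    simp only [G]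
    rw [integral_add ((poly_gauss_integrable _).const_mul _) ((poly_gauss_integrable _).const_mul _),
      integral_const_mul, integral_const_mul, hP_norm, hP_norm, nH_succ, ← hs2]
    field_simp
    ring
  have hle : ∀ y, -G y ≤ (- (Polynomial.C (nH n)⁻¹ * hP n * hP (n+1))).eval y
      * Real.exp (-y^2) := by
    intro y
    have key : (- (Polynomial.C (nH n)⁻¹ * hP n * hP (n+1))).eval y * Real.exp (-y^2) + G y
        = (s * (hP n).eval y - (hP (n+1)).eval y)^2 * Real.exp (-y^2) / (2 * s * nH n) := by
      simp only [G, Polynomial.eval_pow, Polynomial.eval_neg, Polynomial.eval_mul,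
        Polynomial.eval_C]
      field_simp
      ring
    have : 0 ≤ (s * (hP n).eval y - (hP (n+1)).eval y)^2 * Real.exp (-y^2) / (2 * s * nH n) := by
      positivity
    linarith
  have h1 : ∫ y in Set.Ioi x, -G y ≤ ∫ y in Set.Ioi x,
      (- (Polynomial.C (nH n)⁻¹ * hP n * hP (n+1))).eval y * Real.exp (-y^2) :=
    integral_mono hG.neg.integrableOn hi'.integrableOn hle
  have h2 : ∫ y in Set.Ioi x, G y ≤ ∫ y, G y :=
    setIntegral_le_integral hG (Eventually.of_forall hG0)
  rw [integral_neg] at h1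
  linarith

theorem stmt7 :
    ∃ c : ℝ, 0 < c ∧ ∀ (n : ℕ), 1 ≤ n → ∀ x : ℝ,
      ∑ j ∈ Finset.range n, psiH j x ^ 2 ≤ c * Real.sqrt n := by
  refine ⟨Real.sqrt 2, by positivity, ?_⟩
  intro n hn x
  obtain ⟨m, rfl⟩ : ∃ m, n = m + 1 := ⟨n - 1, by omega⟩
  rw [sum_eq, ← Real.sqrt_mul (by norm_num)]
  simpa using main_bound m x
end

section
/- Define K̂_n(ω,y) = Σ_{k=0}^{n−1} (−i)^k ψ_k(ω) ψ_k(y) for ω, y ∈ ℝ (the Fourier transform of the Hermite reproducing kernel K_n(·,y) evaluated at ω). There exist constants c, c' > 0 such that for every integer n ≥ 1, every ω ∈ ℝ, and every y with |y| > 2 n^{1/2}, one has |K̂_n(ω,y)| ≤ c' exp(−c n). -/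
open MeasureTheory Filter ENNReal ProbabilityTheory

theorem aux_iter (k : ℕ) (x : ℝ) :
    iteratedDeriv k (fun t : ℝ => Real.exp (-t ^ 2)) x =
      (iteratedDeriv k (fun z : ℂ => Complex.exp (-z ^ 2)) (x : ℂ)).re := by
  induction k generalizing x with
  | zero =>
    simp only [iteratedDeriv_zero]
    rw [← Complex.ofReal_re (Real.exp (-x ^ 2))]
    push_cast
    rfl
  | succ k ih =>
    have h : iteratedDeriv k (fun t : ℝ => Real.exp (-t ^ 2)) = fun x : ℝ =>
      (iteratedDeriv k (fun z : ℂ => Complex.exp (-z ^ 2)) (x : ℂ)).re := funext ih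
    rw [iteratedDeriv_succ, iteratedDeriv_succ, h]
    have hd : ContDiff ℂ ⊤ (fun z : ℂ => Complex.exp (-z ^ 2)) := by fun_prop
    have hdd : Differentiable ℂ (iteratedDeriv k (fun z : ℂ => Complex.exp (-z ^ 2))) :=
      hd.differentiable_iteratedDeriv k (WithTop.coe_lt_top _)
    exact ((hdd (x : ℂ)).hasDerivAt.real_of_complex).deriv

theorem aux_bound (k : ℕ) (x ρ M : ℝ) (hρ : 0 < ρ)
    (hM : ∀ v w : ℝ, v ^ 2 + w ^ 2 = ρ ^ 2 → -(x + v) ^ 2 + w ^ 2 ≤ M) :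
    |iteratedDeriv k (fun t : ℝ => Real.exp (-t ^ 2)) x| ≤
      (Nat.factorial k : ℝ) * Real.exp M / ρ ^ k := by
  rw [aux_iter]
  refine (Complex.abs_re_le_norm _).trans ?_
  apply Complex.norm_iteratedDeriv_le_of_forall_mem_sphere_norm_le k hρ
  · have : Differentiable ℂ (fun z : ℂ => Complex.exp (-z ^ 2)) := by fun_prop
    exact this.diffContOnCl
  · intro z hz
    rw [Complex.norm_exp, Real.exp_le_exp]
    rw [mem_sphere_iff_norm] at hz
    have h2 := Complex.sq_norm (z - x)
    rw [hz, Complex.normSq_apply] at h2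
    simp only [Complex.sub_re, Complex.sub_im, Complex.ofReal_re, Complex.ofReal_im] at h2
    have := hM (z.re - x) z.im (by rw [h2]; ring)
    have e : (-z ^ 2).re = -(x + (z.re - x)) ^ 2 + z.im ^ 2 := by
      simp [pow_two]; ring
    rw [e]; exact this

theorem aux_fact (k : ℕ) : (Nat.factorial k : ℝ) * Real.exp k ≤ ((k : ℝ) + 1) ^ (k + 1) := by
  induction k with
  | zero => simp
  | succ k ih =>
    have h1 : ((k : ℝ) + 1) ^ (k + 2) * Real.exp 1 ≤ ((k : ℝ) + 2) ^ (k + 2) := by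
      have hN : (0 : ℝ) < (k : ℝ) + 2 := by positivity
      have h := Real.add_one_le_exp (-(1 / ((k : ℝ) + 2)))
      have h' : ((k : ℝ) + 1) * Real.exp (1 / ((k : ℝ) + 2)) ≤ (k : ℝ) + 2 := by
        have e : -(1 / ((k : ℝ) + 2)) + 1 = ((k : ℝ) + 1) / ((k : ℝ) + 2) := by
          field_simp; ring
        rw [e, Real.exp_neg, div_le_iff₀ hN] at h
        have hp := Real.exp_pos (1 / ((k : ℝ) + 2))
        calc _ ≤ ((Real.exp (1 / ((k : ℝ) + 2)))⁻¹ * ((k : ℝ) + 2)) * Real.exp (1 / ((k : ℝ) + 2)) := by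
              gcongr
          _ = _ := by field_simp
      have h3 := pow_le_pow_left₀ (by positivity) h' (k + 2)
      rw [mul_pow, ← Real.exp_nat_mul] at h3
      have e2 : ((k + 2 : ℕ) : ℝ) * (1 / ((k : ℝ) + 2)) = 1 := by
        push_cast; field_simp
      rwa [e2] at h3
    rw [Nat.factorial_succ]
    push_cast
    rw [Real.exp_add]
    calc _ = ((k : ℝ) + 1) * ((Nat.factorial k : ℝ) * Real.exp k) * Real.exp 1 := by ring
      _ ≤ ((k : ℝ) + 1) * (((k : ℝ) + 1) ^ (k + 1)) * Real.exp 1 := by gcongr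
      _ = ((k : ℝ) + 1) ^ (k + 2) * Real.exp 1 := by ring
      _ ≤ _ := h1
      _ = _ := by ring

theorem aux_prod (k : ℕ) (x y ρ τ : ℝ) (hρ : 0 < ρ) (hτ : 0 < τ) (hy : 2 * τ ≤ |y|) :
    |psiH k x * psiH k y| ≤ (Nat.factorial k : ℝ) / (2 * ρ * τ) ^ k *
      Real.exp (ρ ^ 2 - y ^ 2 / 2 + 2 * |y| * τ - τ ^ 2) := by
  have h1 := aux_bound k x ρ (ρ ^ 2 - x ^ 2 / 2) hρ (by
    intro v w h
    nlinarith [sq_nonneg (x + 2 * v)])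
  have h2 := aux_bound k y τ (-y ^ 2 + 2 * |y| * τ - τ ^ 2) hτ (by
    intro v w h
    have hv : |v| ≤ τ := abs_le_of_sq_le_sq (by nlinarith [sq_nonneg w]) hτ.le
    have h3 : -(y * v) ≤ |y| * |v| := by rw [← abs_mul]; exact neg_le_abs _
    have h4 : |v| ^ 2 = v ^ 2 := sq_abs v
    nlinarith [mul_nonneg (sub_nonneg.2 hv) (show 0 ≤ |y| - τ - |v| by linarith)])
  set B : ℝ := Real.sqrt Real.pi * 2 ^ k * (Nat.factorial k : ℝ) with hB
  have hBp : 0 < B := by positivity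
  have hs : 1 ≤ Real.sqrt Real.pi := by
    rw [Real.one_le_sqrt]; linarith [Real.pi_gt_three]
  have hBB : B ^ (-(1 : ℝ) / 2) * B ^ (-(1 : ℝ) / 2) = B⁻¹ := by
    rw [← Real.rpow_add hBp, ← Real.rpow_neg_one]; norm_num
  have hle : B⁻¹ ≤ (2 ^ k * (Nat.factorial k : ℝ))⁻¹ := by
    apply inv_anti₀ (by positivity)
    rw [hB, mul_assoc]
    exact le_mul_of_one_le_left (by positivity) hs
  set D1 := iteratedDeriv k (fun t : ℝ => Real.exp (-t ^ 2)) x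
  set D2 := iteratedDeriv k (fun t : ℝ => Real.exp (-t ^ 2)) y
  have e0 : |psiH k x * psiH k y| = B⁻¹ * (Real.exp (x ^ 2 / 2) * Real.exp (y ^ 2 / 2) * (|D1| * |D2|)) := by
    unfold psiH
    rw [← hB, ← hBB]
    simp only [abs_mul, abs_pow, abs_neg, abs_one, one_pow, Real.abs_exp]
    rw [abs_of_pos (Real.rpow_pos_of_pos hBp _)]
    ring
  rw [e0]
  have hm : |D1| * |D2| ≤ ((Nat.factorial k : ℝ) * Real.exp (ρ ^ 2 - x ^ 2 / 2) / ρ ^ k) *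
      ((Nat.factorial k : ℝ) * Real.exp (-y ^ 2 + 2 * |y| * τ - τ ^ 2) / τ ^ k) :=
    mul_le_mul h1 h2 (abs_nonneg _) (by positivity)
  calc _ ≤ (2 ^ k * (Nat.factorial k : ℝ))⁻¹ * (Real.exp (x ^ 2 / 2) * Real.exp (y ^ 2 / 2) *
        (((Nat.factorial k : ℝ) * Real.exp (ρ ^ 2 - x ^ 2 / 2) / ρ ^ k) *
      ((Nat.factorial k : ℝ) * Real.exp (-y ^ 2 + 2 * |y| * τ - τ ^ 2) / τ ^ k))) := by gcongr
    _ = (Nat.factorial k : ℝ) / (2 * ρ * τ) ^ k * (Real.exp (x ^ 2 / 2) * Real.exp (y ^ 2 / 2) *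
        Real.exp (ρ ^ 2 - x ^ 2 / 2) * Real.exp (-y ^ 2 + 2 * |y| * τ - τ ^ 2)) := by
      have : (Nat.factorial k : ℝ) ≠ 0 := by positivity
      rw [mul_pow, mul_pow]
      field_simp
    _ = _ := by
      rw [← Real.exp_add, ← Real.exp_add, ← Real.exp_add]
      congr 2
      ring

theorem aux_term (n k : ℕ) (hk : k < n) (x y : ℝ) (hy : 2 * Real.sqrt n < |y|) :
    |psiH k x * psiH k y| ≤ n * Real.exp (-(2 / 5) * n) := by
  have hn : (0 : ℝ) < n := by exact_mod_cast (by omega : 0 < n)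
  have hs := Real.sqrt_pos.2 hn
  have hs2 := Real.sq_sqrt hn.le
  set s := Real.sqrt n
  refine (aux_prod k x y (7 / 10 * s) (3 / 10 * s) (by positivity) (by positivity)
    (by linarith)).trans ?_
  apply mul_le_mul _ _ (Real.exp_pos _).le hn.le
  · have e : 2 * (7 / 10 * s) * (3 / 10 * s) = 21 / 50 * n := by rw [← hs2]; ring
    rw [e, div_le_iff₀ (by positivity)]
    have h1 := aux_fact k
    have h2 : ((k : ℝ) + 1) ^ (k + 1) ≤ (n : ℝ) ^ (k + 1) := by
      gcongr
      exact_mod_cast hk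
    have h3 : (1 : ℝ) ≤ (21 / 50 * Real.exp 1) ^ k := by
      apply one_le_pow₀
      linarith [Real.exp_one_gt_d9]
    have h4 : Real.exp k = Real.exp 1 ^ k := by rw [← Real.exp_nat_mul, mul_one]
    have hp := Real.exp_pos k
    rw [mul_pow, ← h4] at h3
    rw [mul_pow]
    refine le_of_mul_le_mul_right (?_ : _ * Real.exp k ≤ _ * Real.exp k) hp
    calc _ ≤ (n : ℝ) ^ (k + 1) := h1.trans h2
      _ ≤ (n : ℝ) ^ (k + 1) * ((21 / 50) ^ k * Real.exp k) :=
        le_mul_of_one_le_right (by positivity) h3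
      _ = _ := by ring
  · rw [Real.exp_le_exp, ← sq_abs y]
    nlinarith [mul_pos (sub_pos.2 hy) hs, sq_nonneg (|y| - 2 * s)]

theorem stmt9 :
    ∃ c : ℝ, 0 < c ∧ ∃ c' : ℝ, 0 < c' ∧ ∀ (n : ℕ), 1 ≤ n → ∀ ω y : ℝ, 2 * Real.sqrt n < |y| →
      ‖∑ k ∈ Finset.range n, (-Complex.I) ^ k * (psiH k ω : ℂ) * (psiH k y : ℂ)‖ ≤
        c' * Real.exp (-c * n) := by
  refine ⟨1 / 5, by norm_num, 100, by norm_num, ?_⟩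
  intro n _ ω y hy
  have h1 : ‖∑ k ∈ Finset.range n, (-Complex.I) ^ k * (psiH k ω : ℂ) * (psiH k y : ℂ)‖ ≤
      ∑ _k ∈ Finset.range n, (n : ℝ) * Real.exp (-(2 / 5) * n) := by
    refine norm_sum_le_of_le _ fun k hk => ?_
    have := aux_term n k (Finset.mem_range.1 hk) ω y hy
    rw [abs_mul] at this
    simpa using this
  refine h1.trans ?_
  rw [Finset.sum_const, Finset.card_range, nsmul_eq_mul]
  have h2 : (n : ℝ) ≤ 10 * Real.exp (n / 10) := by
    linarith [Real.add_one_le_exp ((n : ℝ) / 10)]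
  calc _ = (n : ℝ) * n * Real.exp (-(2 / 5) * n) := by ring
    _ ≤ (10 * Real.exp (n / 10)) * (10 * Real.exp (n / 10)) * Real.exp (-(2 / 5) * n) := by gcongr
    _ = 100 * (Real.exp (n / 10) * Real.exp (n / 10) * Real.exp (-(2 / 5) * n)) := by ring
    _ = _ := by
      rw [← Real.exp_add, ← Real.exp_add]
      congr 2
      ring
end

section
/- There exists a constant c > 0 such that for every integer n ≥ 1, every 1 ≤ p ≤ ∞, and every weighted polynomial P ∈ Π_n, the Bernstein inequality ‖P'‖_p ≤ c √n ‖P‖_p holds. -/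
open MeasureTheory Filter ENNReal ProbabilityTheory

noncomputable def al (k : ℕ) : ℝ := Real.sqrt ((k : ℝ) / 2)

lemma al_zero : al 0 = 0 := by simp [al]
lemma al_nonneg (k : ℕ) : 0 ≤ al k := Real.sqrt_nonneg _
lemma al_sq (k : ℕ) : al k ^ 2 = (k : ℝ) / 2 := Real.sq_sqrt (by positivity)
lemma al_succ_pos (k : ℕ) : 0 < al (k + 1) := Real.sqrt_pos.2 (by positivity)
lemma al_mono {j k : ℕ} (h : j ≤ k) : al j ≤ al k := by
  apply Real.sqrt_le_sqrt
  have : (j : ℝ) ≤ k := by exact_mod_cast h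
  linarith

noncomputable def gd (k : ℕ) : ℝ → ℝ := iteratedDeriv k (fun t : ℝ => Real.exp (-t ^ 2))

lemma gd_zero (x : ℝ) : gd 0 x = Real.exp (-x ^ 2) := by simp [gd]

lemma gd_hasDeriv (k : ℕ) (x : ℝ) : HasDerivAt (gd k) (gd (k + 1) x) x := by
  have hc : ContDiff ℝ (k + 1 : ℕ) (fun t : ℝ => Real.exp (-t ^ 2)) := by fun_prop
  have hd : Differentiable ℝ (gd k) :=
    hc.differentiable_iteratedDeriv k (by exact_mod_cast Nat.lt_succ_self k)
  have := (hd x).hasDerivAt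
  rwa [show deriv (gd k) x = gd (k + 1) x by simp [gd, iteratedDeriv_succ]] at this

lemma gd_one (x : ℝ) : gd 1 x = -2 * x * gd 0 x := by
  have h := gd_hasDeriv 0 x
  have h2 : HasDerivAt (gd 0) (-2 * x * gd 0 x) x := by
    have e : gd 0 = fun t : ℝ => Real.exp (-t ^ 2) := funext gd_zero
    rw [e]
    have := ((hasDerivAt_pow 2 x).neg).exp
    refine this.congr_deriv ?_
    simp only [Pi.neg_apply]
    push_cast
    ring
  exact h.unique h2

lemma gd_rec (k : ℕ) (x : ℝ) :
    gd (k + 2) x = -2 * x * gd (k + 1) x - 2 * ((k : ℝ) + 1) * gd k x := by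
  induction k generalizing x with
  | zero =>
    have h := gd_hasDeriv 1 x
    have e : gd 1 = fun t : ℝ => -2 * t * gd 0 t := funext gd_one
    have h2 : HasDerivAt (gd 1) (-2 * gd 0 x + -2 * x * gd 1 x) x := by
      conv => enter [1]; rw [e]
      have := ((hasDerivAt_id x).const_mul (-2 : ℝ)).mul (gd_hasDeriv 0 x)
      refine this.congr_deriv ?_
      simp
    have := h.unique h2
    norm_num at this ⊢
    linarith
  | succ k ih =>
    have h := gd_hasDeriv (k + 2) x
    have e : gd (k + 2) = fun t : ℝ => -2 * t * gd (k + 1) t - 2 * ((k : ℝ) + 1) * gd k t :=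
      funext ih
    have h2 : HasDerivAt (gd (k + 2)) ((-2 * gd (k + 1) x + -2 * x * gd (k + 2) x)
        - 2 * ((k : ℝ) + 1) * gd (k + 1) x) x := by
      conv => enter [1]; rw [e]
      have := (((hasDerivAt_id x).const_mul (-2 : ℝ)).mul (gd_hasDeriv (k + 1) x)).sub
        ((gd_hasDeriv k x).const_mul (2 * ((k : ℝ) + 1)))
      refine this.congr_deriv ?_
      simp
    have := h.unique h2
    rw [show k + 1 + 2 = k + 2 + 1 by ring, this]
    push_cast
    ring

noncomputable def cn (k : ℕ) : ℝ :=
  (Real.sqrt Real.pi * 2 ^ k * (Nat.factorial k : ℝ)) ^ (-(1 : ℝ) / 2)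

lemma cn_succ (k : ℕ) : 2 * al (k + 1) * cn (k + 1) = cn k := by
  unfold cn al
  have hp : 0 < Real.sqrt Real.pi * 2 ^ k * (Nat.factorial k : ℝ) := by positivity
  rw [show Real.sqrt Real.pi * 2 ^ (k + 1) * (Nat.factorial (k + 1) : ℝ)
    = (Real.sqrt Real.pi * 2 ^ k * (Nat.factorial k : ℝ)) * (2 * ((k : ℝ) + 1)) by
      rw [Nat.factorial_succ]; push_cast; ring]
  rw [Real.mul_rpow hp.le (by positivity)]
  have h2 : (2 * ((k : ℝ) + 1)) ^ (-(1 : ℝ) / 2) = (Real.sqrt (2 * ((k : ℝ) + 1)))⁻¹ := by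
    rw [neg_div, Real.rpow_neg (by positivity), Real.sqrt_eq_rpow]
  have h3 : 2 * Real.sqrt (((k + 1 : ℕ) : ℝ) / 2) = Real.sqrt (2 * ((k : ℝ) + 1)) := by
    rw [show (2 * ((k : ℝ) + 1)) = 2 ^ 2 * (((k + 1 : ℕ) : ℝ) / 2) by push_cast; ring,
      Real.sqrt_mul (by positivity), Real.sqrt_sq (by norm_num)]
  rw [h2, h3]
  have : Real.sqrt (2 * ((k : ℝ) + 1)) ≠ 0 := by positivity
  field_simp

lemma psi_eq (k : ℕ) (x : ℝ) :
    psiH k x = cn k * (-1) ^ k * Real.exp (x ^ 2 / 2) * gd k x := rfl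

lemma psi_rec (k : ℕ) (x : ℝ) :
    x * psiH k x = al (k + 1) * psiH (k + 1) x + al k * psiH (k - 1) x := by
  rcases k with _ | k
  · have := cn_succ 0
    simp only [psi_eq, al_zero, ← this, zero_add, gd_one]
    ring
  · have h1 := cn_succ k
    have h2 := cn_succ (k + 1)
    have hs := al_sq (k + 1)
    push_cast at hs
    simp only [psi_eq, Nat.add_sub_cancel, ← h1, gd_rec]
    rw [show k + 1 + 1 = k + 2 by ring] at *
    rw [← h2]
    have : (k : ℝ) + 1 = 2 * al (k + 1) ^ 2 := by linarith
    rw [this]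
    ring

lemma psi_deriv (k : ℕ) (x : ℝ) :
    HasDerivAt (psiH k) (al k * psiH (k - 1) x - al (k + 1) * psiH (k + 1) x) x := by
  have h1 := cn_succ k
  have hr := psi_rec k x
  have h : HasDerivAt (fun x => (cn k * (-1) ^ k) * (Real.exp (x ^ 2 / 2) * gd k x))
      ((cn k * (-1) ^ k) * ((Real.exp (x ^ 2 / 2) * x) * gd k x
        + Real.exp (x ^ 2 / 2) * gd (k + 1) x)) x := by
    refine HasDerivAt.const_mul _ (HasDerivAt.mul ?_ (gd_hasDeriv k x))
    refine HasDerivAt.exp ?_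
    exact ((hasDerivAt_pow 2 x).div_const 2).congr_deriv (by simp)
  have e : psiH k = (fun x => (cn k * (-1) ^ k) * (Real.exp (x ^ 2 / 2) * gd k x)) := by
    funext t; rw [psi_eq]; ring
  rw [e]
  convert h using 1
  rw [show al k * psiH (k - 1) x = x * psiH k x - al (k + 1) * psiH (k + 1) x by linarith]
  rw [psi_eq, psi_eq, ← h1]
  ring

lemma psi_poly (k : ℕ) : ∃ Q : Polynomial ℝ, ∀ x, psiH k x = Q.eval x * Real.exp (-x ^ 2 / 2) := by
  induction k using Nat.strong_induction_on with
  | _ k ih =>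
    rcases k with _ | k
    · refine ⟨Polynomial.C (cn 0), fun x => ?_⟩
      rw [psi_eq, gd_zero, Polynomial.eval_C, pow_zero, mul_one, mul_assoc, ← Real.exp_add]
      congr 2; ring
    · obtain ⟨Q1, h1⟩ := ih k (by omega)
      obtain ⟨Q2, h2⟩ := ih (k - 1) (by omega)
      refine ⟨Polynomial.C (al (k + 1))⁻¹ * (Polynomial.X * Q1 - Polynomial.C (al k) * Q2), fun x => ?_⟩
      have := psi_rec k x
      have hp := (al_succ_pos k).ne'
      simp only [Polynomial.eval_mul, Polynomial.eval_C, Polynomial.eval_sub, Polynomial.eval_X]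
      rw [h1, h2] at this
      rw [mul_assoc, eq_inv_mul_iff_mul_eq₀ hp]
      linarith

lemma psi_cont (k : ℕ) : Continuous (psiH k) :=
  continuous_iff_continuousAt.2 fun x => (psi_deriv k x).continuousAt

lemma poly_gauss_int (Q : Polynomial ℝ) {b : ℝ} (hb : 0 < b) :
    Integrable (fun x : ℝ => Q.eval x * Real.exp (-b * x ^ 2)) := by
  induction Q using Polynomial.induction_on' with
  | add p q hp hq =>
    simp only [Polynomial.eval_add, add_mul]; exact hp.add hq
  | monomial n a =>
    have := (integrable_rpow_mul_exp_neg_mul_sq hb (s := n)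
      (by have : (0:ℝ) ≤ n := Nat.cast_nonneg n
          linarith)).const_mul a
    simpa [mul_assoc] using this

lemma psi_int (k : ℕ) : Integrable (psiH k) := by
  obtain ⟨Q, h⟩ := psi_poly k
  have := poly_gauss_int Q (b := 1/2) (by norm_num)
  refine this.congr (Eventually.of_forall fun x => ?_)
  simp only
  rw [h]; congr 2; ring

lemma psi_mul_int (j k : ℕ) : Integrable (fun x => psiH j x * psiH k x) := by
  obtain ⟨Q, h⟩ := psi_poly k
  obtain ⟨R, h'⟩ := psi_poly j
  have := poly_gauss_int (R * Q) (b := 1) (by norm_num)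
  refine this.congr (Eventually.of_forall fun x => ?_)
  simp only
  rw [h, h', Polynomial.eval_mul, mul_mul_mul_comm, ← Real.exp_add]; congr 2; ring

lemma ip_rec (j k : ℕ) : al (j + 1) * ∫ x, psiH (j + 1) x * psiH k x
    = al k * ∫ x, psiH j x * psiH (k - 1) x := by
  have hibp := integral_mul_deriv_eq_deriv_mul_of_integrable
    (u := psiH j) (v := psiH k) (fun x _ => psi_deriv j x) (fun x _ => psi_deriv k x)
    (by
      have := ((psi_mul_int j (k - 1)).const_mul (al k)).sub
        ((psi_mul_int j (k + 1)).const_mul (al (k + 1)))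
      refine this.congr (Eventually.of_forall fun x => ?_)
      simp only [Pi.mul_apply, Pi.sub_apply]
      ring)
    (by
      have := ((psi_mul_int (j - 1) k).const_mul (al j)).sub
        ((psi_mul_int (j + 1) k).const_mul (al (j + 1)))
      refine this.congr (Eventually.of_forall fun x => ?_)
      simp only [Pi.mul_apply, Pi.sub_apply]
      ring)
    (psi_mul_int j k)
  have e1 : ∀ x, psiH j x * (al k * psiH (k - 1) x - al (k + 1) * psiH (k + 1) x)
      = 2 * al k * (psiH j x * psiH (k - 1) x) - x * psiH j x * psiH k x := by
    intro x
    linear_combination psiH j x * psi_rec k x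
  have e2 : ∀ x, (al j * psiH (j - 1) x - al (j + 1) * psiH (j + 1) x) * psiH k x
      = x * psiH j x * psiH k x - 2 * al (j + 1) * (psiH (j + 1) x * psiH k x) := by
    intro x
    linear_combination - psiH k x * psi_rec j x
  have hx : Integrable (fun x => x * psiH j x * psiH k x) := by
    have := ((psi_mul_int (j - 1) k).const_mul (al j)).add
        ((psi_mul_int (j + 1) k).const_mul (al (j + 1)))
    refine this.congr (Eventually.of_forall fun x => ?_)
    simp only [Pi.add_apply]
    rw [psi_rec]; ring
  simp only [e1, e2] at hibp
  rw [integral_sub ((psi_mul_int _ _).const_mul _) hx,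
    integral_sub hx ((psi_mul_int _ _).const_mul _), integral_const_mul, integral_const_mul] at hibp
  linarith

lemma ip_zero : ∫ x, psiH 0 x * psiH 0 x = 1 := by
  have e : ∀ x, psiH 0 x * psiH 0 x = (cn 0 * cn 0) * Real.exp (-1 * x ^ 2) := by
    intro x
    have : Real.exp (-1 * x ^ 2) = (Real.exp (x ^ 2 / 2) * Real.exp (-x ^ 2)) *
      (Real.exp (x ^ 2 / 2) * Real.exp (-x ^ 2)) := by
      simp only [← Real.exp_add]; congr 1; ring
    rw [this, psi_eq, gd_zero]; ring
  simp only [e]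
  rw [integral_const_mul, integral_gaussian]
  have hp : 0 < Real.sqrt Real.pi := by positivity
  have : cn 0 * cn 0 = (Real.sqrt Real.pi)⁻¹ := by
    simp only [cn, pow_zero, Nat.factorial_zero, Nat.cast_one, mul_one]
    rw [← Real.rpow_add hp, ← Real.rpow_neg_one]
    norm_num
  rw [this, div_one]
  field_simp

lemma ip (j k : ℕ) : ∫ x, psiH j x * psiH k x = if j = k then 1 else 0 := by
  induction j generalizing k with
  | zero =>
    rcases k with _ | k
    · simpa using ip_zero
    · have := ip_rec k 0
      rw [al_zero, zero_mul] at this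
      have h := (mul_eq_zero.1 this).resolve_left (al_succ_pos k).ne'
      simp only [mul_comm (psiH 0 _)]
      simpa using h
  | succ j ih =>
    have := ip_rec j k
    rw [ih] at this
    rcases k with _ | k
    · rw [al_zero, zero_mul] at this
      have h := (mul_eq_zero.1 this).resolve_left (al_succ_pos j).ne'
      simpa using h
    · by_cases hjk : j = k
      · subst hjk
        simp only [Nat.add_sub_cancel, if_true] at this ⊢
        exact mul_left_cancel₀ (al_succ_pos j).ne' this
      · simp only [Nat.add_sub_cancel, hjk, if_false, mul_zero] at this
        have h := (mul_eq_zero.1 this).resolve_left (al_succ_pos j).ne'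
        simpa [hjk] using h

lemma comb_mul_int (c d : ℕ → ℝ) (r s m l : ℕ) :
    Integrable (fun x => (∑ k ∈ Finset.range m, c k * psiH (k + r) x) *
      (∑ k ∈ Finset.range l, d k * psiH (k + s) x)) := by
  simp only [Finset.sum_mul_sum]
  refine integrable_finsetSum _ fun i _ => integrable_finsetSum _ fun j _ => ?_
  refine ((psi_mul_int (i + r) (j + s)).const_mul (c i * d j)).congr
    (Eventually.of_forall fun x => ?_)
  simp only; ring

lemma comb_psi (c : ℕ → ℝ) (r m j : ℕ) :
    ∫ x, (∑ k ∈ Finset.range m, c k * psiH (k + r) x) * psiH j x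
      = ∑ k ∈ Finset.range m, if k + r = j then c k else 0 := by
  simp only [Finset.sum_mul, mul_assoc]
  rw [integral_finsetSum _ fun i _ => (psi_mul_int _ _).const_mul _]
  refine Finset.sum_congr rfl fun k _ => ?_
  rw [integral_const_mul, ip]
  simp

lemma parseval (c : ℕ → ℝ) (r m : ℕ) :
    ∫ x, (∑ k ∈ Finset.range m, c k * psiH (k + r) x) ^ 2 = ∑ k ∈ Finset.range m, c k ^ 2 := by
  have e : ∀ x, (∑ k ∈ Finset.range m, c k * psiH (k + r) x) ^ 2
      = ∑ j ∈ Finset.range m, c j *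
        ((∑ k ∈ Finset.range m, c k * psiH (k + r) x) * psiH (j + r) x) := by
    intro x
    rw [sq]
    nth_rewrite 2 [Finset.sum_congr rfl fun k _ => rfl]
    rw [Finset.mul_sum]
    exact Finset.sum_congr rfl fun j _ => by ring
  simp only [e]
  rw [integral_finsetSum]
  · refine Finset.sum_congr rfl fun j hj => ?_
    rw [integral_const_mul, comb_psi]
    simp only [Nat.add_right_cancel_iff]
    rw [Finset.sum_ite_eq' , if_pos hj]; ring
  · intro j _
    refine Integrable.const_mul ?_ _
    simp only [Finset.sum_mul, mul_assoc]
    exact integrable_finsetSum _ fun i _ => (psi_mul_int _ _).const_mul _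

lemma S_bound (m : ℕ) (x : ℝ) :
    ∑ k ∈ Finset.range m, psiH k x ^ 2 ≤ 2 * al m := by
  set S : ℝ → ℝ := fun x => ∑ k ∈ Finset.range m, psiH k x ^ 2 with hS
  have hd : ∀ x, HasDerivAt S (-(2 * al m) * (psiH (m - 1) x * psiH m x)) x := by
    intro x
    have h1 : HasDerivAt S (∑ k ∈ Finset.range m, (2 * psiH k x *
        (al k * psiH (k - 1) x - al (k + 1) * psiH (k + 1) x))) x := by
      refine HasDerivAt.fun_sum fun k _ => ?_
      exact ((psi_deriv k x).pow 2).congr_deriv (by simp)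
    convert h1 using 1
    clear h1 hS
    clear S
    induction m with
    | zero => simp [al_zero]
    | succ m ih =>
      rw [Finset.sum_range_succ, ← ih, Nat.add_sub_cancel]; ring
  have hSi : Integrable S := by
    refine integrable_finsetSum _ fun k _ => ?_
    simpa [sq] using psi_mul_int k k
  have hdi : Integrable (fun x => -(2 * al m) * (psiH (m - 1) x * psiH m x)) :=
    (psi_mul_int _ _).const_mul _
  have ht := tendsto_zero_of_hasDerivAt_of_integrableOn_Iic (a := x) (fun y _ => hd y)
    hdi.integrableOn hSi.integrableOn
  have hbnd := integral_Iic_of_hasDerivAt_of_tendsto' (a := x) (fun y _ => hd y)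
    hdi.integrableOn ht
  rw [sub_zero] at hbnd
  change S x ≤ _
  rw [← hbnd]
  have hq : Integrable (fun x => al m * (psiH (m - 1) x * psiH (m - 1) x) +
      al m * (psiH m x * psiH m x)) :=
    ((psi_mul_int _ _).const_mul _).add ((psi_mul_int _ _).const_mul _)
  calc _ ≤ ∫ y in Set.Iic x, (al m * (psiH (m - 1) y * psiH (m - 1) y) +
      al m * (psiH m y * psiH m y)) := by
        refine integral_mono hdi.integrableOn hq.integrableOn fun y => ?_
        have := al_nonneg m
        nlinarith [mul_nonneg this (sq_nonneg (psiH (m - 1) y + psiH m y))]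
    _ ≤ ∫ y, (al m * (psiH (m - 1) y * psiH (m - 1) y) + al m * (psiH m y * psiH m y)) := by
        refine setIntegral_le_integral hq (Eventually.of_forall fun y => ?_)
        have := al_nonneg m
        have h1 := mul_self_nonneg (psiH (m - 1) y)
        have h2 := mul_self_nonneg (psiH m y)
        simp only [Pi.zero_apply]; positivity
    _ = 2 * al m := by
        rw [integral_add ((psi_mul_int _ _).const_mul _) ((psi_mul_int _ _).const_mul _),
          integral_const_mul, integral_const_mul, ip, ip]
        simp; ring

lemma S_shift (m r : ℕ) (x : ℝ) :
    ∑ k ∈ Finset.range m, psiH (k + r) x ^ 2 ≤ ∑ k ∈ Finset.range (m + r), psiH k x ^ 2 := by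
  induction m with
  | zero => simpa using Finset.sum_nonneg fun k _ => sq_nonneg (psiH k x)
  | succ m ih =>
    rw [Finset.sum_range_succ, show m + 1 + r = m + r + 1 by ring, Finset.sum_range_succ]
    linarith

lemma S_bound' (n r : ℕ) (hn : 1 ≤ n) (hr : r ≤ 2) (x : ℝ) :
    ∑ k ∈ Finset.range (2 * n + 1), psiH (k + r) x ^ 2 ≤ 4 * Real.sqrt n := by
  refine (S_shift _ r x).trans ((S_bound _ x).trans ?_)
  have hn' : (1 : ℝ) ≤ n := by exact_mod_cast hn
  have hr' : (r : ℝ) ≤ 2 := by exact_mod_cast hr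
  have h1 : al (2 * n + 1 + r) ≤ Real.sqrt (2 ^ 2 * n) := by
    apply Real.sqrt_le_sqrt
    push_cast
    linarith
  rw [Real.sqrt_mul (by norm_num), Real.sqrt_sq (by norm_num)] at h1
  linarith

noncomputable def Ak (g : ℕ → ℝ) (m : ℕ) (x y : ℝ) : ℝ :=
  ∑ k ∈ Finset.range m, al (k + 1) * g k * psiH (k + 1) x * psiH k y

lemma Ak_comm (g : ℕ → ℝ) (m : ℕ) (x y : ℝ) :
    (x - y) * Ak g m x y =
      ∑ k ∈ Finset.range m, (al (k + 1) * al (k + 2) * (g k - g (k + 1))) * psiH (k + 2) x * psiH k y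
      + ∑ k ∈ Finset.range m, (((k : ℝ) + 1) * g k - k * g (k - 1)) / 2 * psiH k x * psiH k y
      + g m * al m * al (m + 1) * psiH (m + 1) x * psiH (m - 1) y
      - (m : ℝ) / 2 * g (m - 1) * psiH m x * psiH m y := by
  unfold Ak
  induction m with
  | zero => simp [al_zero]
  | succ m ih =>
    rw [Finset.sum_range_succ, mul_add, ih, Finset.sum_range_succ, Finset.sum_range_succ]
    have r1 := psi_rec (m + 1) x
    have r2 := psi_rec m y
    have hs := al_sq (m + 1)
    simp only [Nat.add_sub_cancel] at r1 ⊢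
    push_cast at hs ⊢
    rw [show m + 1 + 1 = m + 2 by ring] at *
    linear_combination (al (m + 1) * g m * psiH m y) * r1 - (al (m + 1) * g m * psiH (m + 1) x) * r2
      + (g m * psiH m x * psiH m y - g m * psiH (m + 1) x * psiH (m + 1) y) * hs

lemma comb_cont (c : ℕ → ℝ) (r m : ℕ) :
    Continuous (fun x => ∑ k ∈ Finset.range m, c k * psiH (k + r) x) :=
  continuous_finsetSum _ fun k _ => continuous_const.mul (psi_cont _)

lemma comb_sq_int (c : ℕ → ℝ) (r m : ℕ) :
    Integrable (fun x => (∑ k ∈ Finset.range m, c k * psiH (k + r) x) ^ 2) := by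
  simpa [sq] using comb_mul_int c c r r m m

lemma cauchy_int (n : ℝ) (hn : 0 < n) (a : ℝ) :
    Integrable (fun y : ℝ => (1 + n * (a - y) ^ 2)⁻¹) ∧
    ∫ y : ℝ, (1 + n * (a - y) ^ 2)⁻¹ = Real.pi / Real.sqrt n := by
  have hs : 0 < Real.sqrt n := Real.sqrt_pos.2 hn
  have e : (fun y : ℝ => (1 + n * (a - y) ^ 2)⁻¹)
      = fun y => (fun z : ℝ => (1 + (Real.sqrt n * z) ^ 2)⁻¹) (a - y) := by
    funext y
    simp only [mul_pow, Real.sq_sqrt hn.le]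
  have hi : Integrable (fun z : ℝ => (1 + (Real.sqrt n * z) ^ 2)⁻¹) :=
    integrable_inv_one_add_sq.comp_mul_left' hs.ne'
  constructor
  · rw [e]; exact hi.comp_sub_left a
  · rw [e, integral_sub_left_eq_self (fun z : ℝ => (1 + (Real.sqrt n * z) ^ 2)⁻¹) volume a,
      Measure.integral_comp_mul_left (fun z : ℝ => (1 + z ^ 2)⁻¹), integral_univ_inv_one_add_sq,
      abs_of_pos (inv_pos.2 hs), smul_eq_mul]
    field_simp

lemma sum_le_of (m : ℕ) (C B : ℝ) (hC : 0 ≤ C) (c u : ℕ → ℝ)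
    (h : ∀ k ∈ Finset.range m, c k ^ 2 ≤ C * u k ^ 2)
    (hu : ∑ k ∈ Finset.range m, u k ^ 2 ≤ B) : ∑ k ∈ Finset.range m, c k ^ 2 ≤ C * B := by
  refine (Finset.sum_le_sum h).trans ?_
  rw [← Finset.mul_sum]
  exact mul_le_mul_of_nonneg_left hu hC

lemma L1_bound (n : ℕ) (hn : 1 ≤ n) (F : ℝ → ℝ) (a : ℝ) (c d e u v w : ℕ → ℝ) (r s t m : ℕ)
    (hF : ∀ y, F y = ∑ k ∈ Finset.range m, c k * psiH (k + r) y)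
    (hG : ∀ y, (a - y) * F y = ∑ k ∈ Finset.range m, d k * psiH (k + s) y
      + ∑ k ∈ Finset.range m, e k * psiH (k + t) y)
    (hc : ∀ k ∈ Finset.range m, c k ^ 2 ≤ (3 / 2 * n) * u k ^ 2)
    (hd : ∀ k ∈ Finset.range m, d k ^ 2 ≤ 4 * v k ^ 2)
    (he : ∀ k ∈ Finset.range m, e k ^ 2 ≤ 4 * w k ^ 2)
    (hu : ∑ k ∈ Finset.range m, u k ^ 2 ≤ 4 * Real.sqrt n)
    (hv : ∑ k ∈ Finset.range m, v k ^ 2 ≤ 4 * Real.sqrt n)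
    (hw : ∑ k ∈ Finset.range m, w k ^ 2 ≤ 4 * Real.sqrt n) :
    ∫⁻ y, ‖F y‖ₑ ≤ ENNReal.ofReal (40 * Real.sqrt n) := by
  have hn' : (1 : ℝ) ≤ n := by exact_mod_cast hn
  have hn0 : (0 : ℝ) < n := by linarith
  have hs : 0 < Real.sqrt n := Real.sqrt_pos.2 hn0
  have hss : Real.sqrt n * Real.sqrt n = n := Real.mul_self_sqrt hn0.le
  have c1 := sum_le_of m _ _ (by positivity) c u hc hu
  have d1 := sum_le_of m _ _ (by positivity) d v hd hv
  have e1 := sum_le_of m _ _ (by positivity) e w he hw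
  rw [← parseval c r] at c1
  rw [← parseval d s] at d1
  rw [← parseval e t] at e1
  have ci := comb_sq_int c r m
  have di := comb_sq_int d s m
  have ei := comb_sq_int e t m
  obtain ⟨wi, wv⟩ := cauchy_int n hn0 a
  set Fc : ℝ → ℝ := fun y => ∑ k ∈ Finset.range m, c k * psiH (k + r) y with hFc
  set Fd : ℝ → ℝ := fun y => ∑ k ∈ Finset.range m, d k * psiH (k + s) y with hFd
  set Fe : ℝ → ℝ := fun y => ∑ k ∈ Finset.range m, e k * psiH (k + t) y with hFe
  let H : ℝ → ℝ := fun y => (n : ℝ) / 2 * (1 + (n : ℝ) * (a - y) ^ 2)⁻¹ +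
    (1 / (2 * n) * Fc y ^ 2 + (Fd y ^ 2 + Fe y ^ 2))
  have i1 := wi.const_mul ((n : ℝ) / 2)
  have di' : Integrable (fun y => Fd y ^ 2) := di
  have ei' : Integrable (fun y => Fe y ^ 2) := ei
  have i2 : Integrable (fun y => 1 / (2 * (n : ℝ)) * Fc y ^ 2) := ci.const_mul (1 / (2 * (n : ℝ)))
  have i3 : Integrable (fun y => Fd y ^ 2 + Fe y ^ 2) := di.add ei
  have i23 : Integrable (fun y => 1 / (2 * (n : ℝ)) * Fc y ^ 2 + (Fd y ^ 2 + Fe y ^ 2)) := i2.add i3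
  have Hi : Integrable H := i1.add i23
  have key : ∀ y, |F y| ≤ H y := by
    intro y
    have h1 : F y = Fc y := hF y
    have h2 : (a - y) * F y = Fd y + Fe y := hG y
    have hw0 : 0 < 1 + (n : ℝ) * (a - y) ^ 2 := by positivity
    have h3 : ((a - y) * F y) ^ 2 ≤ 2 * (Fd y ^ 2 + Fe y ^ 2) := by
      rw [h2]; nlinarith [sq_nonneg (Fd y - Fe y)]
    have h4 : (n : ℝ) / 2 * (1 + (n : ℝ) * (a - y) ^ 2)⁻¹ +
      1 / (2 * n) * ((1 + (n : ℝ) * (a - y) ^ 2) * F y ^ 2) - |F y| =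
      (n - (1 + (n : ℝ) * (a - y) ^ 2) * |F y|) ^ 2 / (2 * n * (1 + (n : ℝ) * (a - y) ^ 2)) := by
      rw [← sq_abs (F y)]
      field_simp
      ring
    have h5 : 0 ≤ (n - (1 + (n : ℝ) * (a - y) ^ 2) * |F y|) ^ 2 /
      (2 * n * (1 + (n : ℝ) * (a - y) ^ 2)) := by positivity
    have h6 : 1 / (2 * n) * ((1 + (n : ℝ) * (a - y) ^ 2) * F y ^ 2) =
      1 / (2 * n) * Fc y ^ 2 + ((a - y) * F y) ^ 2 / 2 := by
      rw [h1]; field_simp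
    simp only [H]
    linarith
  have hbnd : ∫ y, H y ≤ 40 * Real.sqrt n := by
    have : ∫ y, H y = (n : ℝ) / 2 * (Real.pi / Real.sqrt n) +
        (1 / (2 * n) * (∫ y, Fc y ^ 2) + ((∫ y, Fd y ^ 2) + ∫ y, Fe y ^ 2)) := by
      rw [← wv, ← integral_const_mul, ← integral_const_mul, ← integral_add di' ei',
        ← integral_add i2 i3, ← integral_add i1 i23]
    rw [this]
    have t1 : (n : ℝ) / 2 * (Real.pi / Real.sqrt n) = Real.pi / 2 * Real.sqrt n := by
      field_simp
      linarith
    have t2 : 1 / (2 * (n : ℝ)) * (∫ y, Fc y ^ 2) ≤ 1 / (2 * n) * (3 / 2 * n * (4 * Real.sqrt n)) :=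
      mul_le_mul_of_nonneg_left c1 (by positivity)
    have t3 : 1 / (2 * (n : ℝ)) * (3 / 2 * n * (4 * Real.sqrt n)) = 3 * Real.sqrt n := by
      field_simp; norm_num
    have t4 : Real.pi / 2 * Real.sqrt n ≤ 2 * Real.sqrt n :=
      mul_le_mul_of_nonneg_right (by linarith [Real.pi_le_four]) hs.le
    linarith
  calc ∫⁻ y, ‖F y‖ₑ ≤ ∫⁻ y, ENNReal.ofReal (H y) := by
        refine lintegral_mono fun y => ?_
        rw [Real.enorm_eq_ofReal_abs]
        exact ENNReal.ofReal_le_ofReal (key y)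
    _ = ENNReal.ofReal (∫ y, H y) :=
        (ofReal_integral_eq_lintegral_ofReal Hi
          (Eventually.of_forall fun y => (abs_nonneg _).trans (key y))).symm
    _ ≤ _ := ENNReal.ofReal_le_ofReal hbnd

structure GoodG (n : ℕ) (g : ℕ → ℝ) : Prop where
  bd : ∀ k, |g k| ≤ 1
  lip : ∀ k, |g k - g (k + 1)| ≤ 1 / n
  van : ∀ k, 2 * n ≤ k → g k = 0

lemma coef_c {n : ℕ} (hn : 1 ≤ n) {g : ℕ → ℝ} (hg : GoodG n g) {k : ℕ}
    (hk : k ∈ Finset.range (2 * n + 1)) : (al (k + 1) * g k) ^ 2 ≤ 3 / 2 * n := by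
  have hk' : (k : ℝ) ≤ 2 * n := by
    exact_mod_cast Nat.lt_succ_iff.1 (Finset.mem_range.1 hk)
  have hn' : (1 : ℝ) ≤ n := by exact_mod_cast hn
  have h1 : g k ^ 2 ≤ 1 := by
    rw [← sq_abs]; exact pow_le_one₀ (abs_nonneg _) (hg.bd k)
  rw [mul_pow, al_sq]
  push_cast
  have : ((k : ℝ) + 1) / 2 * g k ^ 2 ≤ ((k : ℝ) + 1) / 2 * 1 :=
    mul_le_mul_of_nonneg_left h1 (by positivity)
  linarith

lemma coef_d {n : ℕ} (hn : 1 ≤ n) {g : ℕ → ℝ} (hg : GoodG n g) {k : ℕ}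
    (hk : k ∈ Finset.range (2 * n + 1)) :
    (al (k + 1) * al (k + 2) * (g k - g (k + 1))) ^ 2 ≤ 4 := by
  have hk' : (k : ℝ) ≤ 2 * n := by
    exact_mod_cast Nat.lt_succ_iff.1 (Finset.mem_range.1 hk)
  have hn' : (1 : ℝ) ≤ n := by exact_mod_cast hn
  have h1 : (g k - g (k + 1)) ^ 2 ≤ (1 / (n : ℝ)) ^ 2 := by
    rw [← sq_abs]; exact pow_le_pow_left₀ (abs_nonneg _) (hg.lip k) 2
  rw [mul_pow, mul_pow, al_sq, al_sq]
  push_cast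
  have a1 : ((k : ℝ) + 1) / 2 ≤ 2 * n := by linarith
  have a2 : ((k : ℝ) + 2) / 2 ≤ 2 * n := by linarith
  calc ((k : ℝ) + 1) / 2 * (((k : ℝ) + 2) / 2) * (g k - g (k + 1)) ^ 2
      ≤ (2 * n) * (2 * n) * (1 / (n : ℝ)) ^ 2 := by gcongr
    _ = 4 := by field_simp; norm_num

lemma coef_e {n : ℕ} (hn : 1 ≤ n) {g : ℕ → ℝ} (hg : GoodG n g) {k : ℕ}
    (hk : k ∈ Finset.range (2 * n + 1)) :
    ((((k : ℝ) + 1) * g k - k * g (k - 1)) / 2) ^ 2 ≤ 4 := by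
  have hk' : (k : ℝ) ≤ 2 * n := by
    exact_mod_cast Nat.lt_succ_iff.1 (Finset.mem_range.1 hk)
  have hn' : (1 : ℝ) ≤ n := by exact_mod_cast hn
  have h1 : |(k : ℝ) * (g k - g (k - 1))| ≤ 2 := by
    rcases k with _ | k
    · simp
    · rw [abs_mul, abs_of_nonneg (by positivity), abs_sub_comm, Nat.add_sub_cancel]
      calc ((k + 1 : ℕ) : ℝ) * |g k - g (k + 1)| ≤ (2 * n) * (1 / n) :=
            mul_le_mul hk' (hg.lip k) (abs_nonneg _) (by positivity)
        _ = 2 := by field_simp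
  have h2 := hg.bd k
  rw [show (4 : ℝ) = 2 ^ 2 by norm_num]
  rw [abs_le] at h1 h2
  apply sq_le_sq'
  · linarith
  · linarith

lemma Ak_comm' {n : ℕ} {g : ℕ → ℝ} (hg : GoodG n g) (x y : ℝ) :
    (x - y) * Ak g (2 * n + 1) x y =
      ∑ k ∈ Finset.range (2 * n + 1),
        (al (k + 1) * al (k + 2) * (g k - g (k + 1))) * psiH (k + 2) x * psiH k y
      + ∑ k ∈ Finset.range (2 * n + 1),
        (((k : ℝ) + 1) * g k - k * g (k - 1)) / 2 * psiH k x * psiH k y := by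
  rw [Ak_comm, hg.van (2 * n + 1) (by omega), hg.van (2 * n + 1 - 1) (by omega)]
  ring

lemma Ak_L1_y {n : ℕ} (hn : 1 ≤ n) {g : ℕ → ℝ} (hg : GoodG n g) (x : ℝ) :
    ∫⁻ y, ‖Ak g (2 * n + 1) x y‖ₑ ≤ ENNReal.ofReal (40 * Real.sqrt n) := by
  refine L1_bound n hn _ x (fun k => al (k + 1) * g k * psiH (k + 1) x)
    (fun k => (al (k + 1) * al (k + 2) * (g k - g (k + 1))) * psiH (k + 2) x)
    (fun k => (((k : ℝ) + 1) * g k - k * g (k - 1)) / 2 * psiH k x)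
    (fun k => psiH (k + 1) x) (fun k => psiH (k + 2) x) (fun k => psiH (k + 0) x)
    0 0 0 (2 * n + 1) (fun y => rfl) (fun y => Ak_comm' hg x y) ?_ ?_ ?_
    (S_bound' n 1 hn (by norm_num) x) (S_bound' n 2 hn (by norm_num) x)
    (S_bound' n 0 hn (by norm_num) x)
  · intro k hk
    simp only [mul_pow _ (psiH _ _)]
    exact mul_le_mul_of_nonneg_right (coef_c hn hg hk) (sq_nonneg _)
  · intro k hk
    simp only [mul_pow _ (psiH _ _)]
    exact mul_le_mul_of_nonneg_right (coef_d hn hg hk) (sq_nonneg _)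
  · intro k hk
    simp only [mul_pow _ (psiH _ _)]
    exact mul_le_mul_of_nonneg_right (coef_e hn hg hk) (sq_nonneg _)

lemma Ak_L1_x {n : ℕ} (hn : 1 ≤ n) {g : ℕ → ℝ} (hg : GoodG n g) (y : ℝ) :
    ∫⁻ x, ‖Ak g (2 * n + 1) x y‖ₑ ≤ ENNReal.ofReal (40 * Real.sqrt n) := by
  refine L1_bound n hn (fun x => Ak g (2 * n + 1) x y) y (fun k => al (k + 1) * g k * psiH k y)
    (fun k => -(al (k + 1) * al (k + 2) * (g k - g (k + 1))) * psiH k y)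
    (fun k => -((((k : ℝ) + 1) * g k - k * g (k - 1)) / 2) * psiH k y)
    (fun k => psiH (k + 0) y) (fun k => psiH (k + 0) y) (fun k => psiH (k + 0) y)
    1 2 0 (2 * n + 1) (fun x => ?_) (fun x => ?_) ?_ ?_ ?_
    (S_bound' n 0 hn (by norm_num) y) (S_bound' n 0 hn (by norm_num) y)
    (S_bound' n 0 hn (by norm_num) y)
  · exact Finset.sum_congr rfl fun k _ => by ring
  · have := Ak_comm' hg x y
    rw [← neg_sub x y, neg_mul, this, neg_add, ← Finset.sum_neg_distrib, ← Finset.sum_neg_distrib]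
    congr 1
    · exact Finset.sum_congr rfl fun k _ => by ring
    · exact Finset.sum_congr rfl fun k _ => by simp only [add_zero]; ring
  · intro k hk
    simp only [mul_pow _ (psiH _ _)]
    exact mul_le_mul_of_nonneg_right (coef_c hn hg hk) (sq_nonneg _)
  · intro k hk
    simp only [mul_pow _ (psiH _ _), neg_sq]
    exact mul_le_mul_of_nonneg_right (coef_d hn hg hk) (sq_nonneg _)
  · intro k hk
    simp only [mul_pow _ (psiH _ _), neg_sq]
    exact mul_le_mul_of_nonneg_right (coef_e hn hg hk) (sq_nonneg _)

lemma schur_pt (k : ℝ → ℝ≥0∞) (hk : Measurable k) (f : ℝ → ℝ) (hf : Continuous f)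
    (p : ℝ≥0∞) (hp : 1 ≤ p) (hpt : p ≠ ∞) (C : ℝ≥0∞) (hC : ∫⁻ y, k y ≤ C) :
    (∫⁻ y, k y * ‖f y‖ₑ) ^ p.toReal ≤ C ^ (p.toReal - 1) * ∫⁻ y, k y * ‖f y‖ₑ ^ p.toReal := by
  have hq : 1 ≤ p.toReal := by
    rw [← ENNReal.toReal_one]; exact ENNReal.toReal_mono hpt hp
  have hq0 : 0 < p.toReal := by linarith
  have hp0 : p ≠ 0 := (lt_of_lt_of_le one_pos hp).ne'
  have h := eLpNorm_le_eLpNorm_mul_rpow_measure_univ (μ := volume.withDensity k) hp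
    hf.aestronglyMeasurable
  have hm : Measurable (fun y => ‖f y‖ₑ) := hf.measurable.enorm
  rw [eLpNorm_one_eq_lintegral_enorm, eLpNorm_eq_lintegral_rpow_enorm_toReal hp0 hpt,
    lintegral_withDensity_eq_lintegral_mul _ hk hm,
    lintegral_withDensity_eq_lintegral_mul _ hk (hm.pow_const _),
    withDensity_apply _ MeasurableSet.univ, Measure.restrict_univ] at h
  simp only [Pi.mul_apply] at h
  have h2 := ENNReal.rpow_le_rpow h hq0.le
  rw [ENNReal.mul_rpow_of_nonneg _ _ hq0.le, ← ENNReal.rpow_mul, ← ENNReal.rpow_mul,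
    one_div_mul_cancel hq0.ne', ENNReal.rpow_one] at h2
  refine h2.trans ?_
  rw [mul_comm]
  refine mul_le_mul_left ?_ _
  have e : (1 / (1 : ℝ≥0∞).toReal - 1 / p.toReal) * p.toReal = p.toReal - 1 := by
    rw [ENNReal.toReal_one]; field_simp
  rw [e]
  exact ENNReal.rpow_le_rpow hC (by linarith)

lemma schur (K : ℝ → ℝ → ℝ) (hK : Continuous (fun z : ℝ × ℝ => K z.1 z.2)) (C : ℝ≥0∞)
    (hy : ∀ x, ∫⁻ y, ‖K x y‖ₑ ≤ C) (hx : ∀ y, ∫⁻ x, ‖K x y‖ₑ ≤ C)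
    (f : ℝ → ℝ) (hf : Continuous f) (p : ℝ≥0∞) (hp : 1 ≤ p) :
    eLpNorm (fun x => ∫ y, K x y * f y) p volume ≤ C * eLpNorm f p volume := by
  have hb : ∀ x, ‖∫ y, K x y * f y‖ₑ ≤ ∫⁻ y, ‖K x y‖ₑ * ‖f y‖ₑ := fun x => by
    refine (enorm_integral_le_lintegral_enorm _).trans_eq ?_
    simp only [enorm_mul]
  by_cases hpt : p = ∞
  · subst hpt
    rw [eLpNorm_exponent_top, eLpNorm_exponent_top]
    refine eLpNormEssSup_le_of_ae_enorm_bound (Eventually.of_forall fun x => (hb x).trans ?_)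
    calc ∫⁻ y, ‖K x y‖ₑ * ‖f y‖ₑ ≤ ∫⁻ y, ‖K x y‖ₑ * eLpNormEssSup f volume := by
          refine lintegral_mono_ae ?_
          filter_upwards [ae_le_eLpNormEssSup (f := f) (μ := volume)] with y h
          gcongr
      _ = (∫⁻ y, ‖K x y‖ₑ) * eLpNormEssSup f volume := by
          refine lintegral_mul_const _ ?_
          exact (hK.comp (by fun_prop : Continuous fun y : ℝ => (x, y))).measurable.enorm
      _ ≤ _ := by gcongr; exact hy x
  · have hq : 1 ≤ p.toReal := by
      rw [← ENNReal.toReal_one]; exact ENNReal.toReal_mono hpt hp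
    have hq0 : 0 < p.toReal := by linarith
    have hp0 : p ≠ 0 := (lt_of_lt_of_le one_pos hp).ne'
    have hm : Measurable (fun z : ℝ × ℝ => ‖K z.1 z.2‖ₑ * ‖f z.2‖ₑ ^ p.toReal) :=
      hK.measurable.enorm.mul ((hf.measurable.comp measurable_snd).enorm.pow_const _)
    have hmy : ∀ x, Measurable (fun y => ‖K x y‖ₑ) := fun x =>
      (hK.comp (by fun_prop : Continuous fun y : ℝ => (x, y))).measurable.enorm
    have hmx : ∀ y, Measurable (fun x => ‖K x y‖ₑ) := fun y =>
      (hK.comp (by fun_prop : Continuous fun x : ℝ => (x, y))).measurable.enorm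
    rw [eLpNorm_eq_lintegral_rpow_enorm_toReal hp0 hpt,
      eLpNorm_eq_lintegral_rpow_enorm_toReal hp0 hpt]
    have main : ∫⁻ x, ‖∫ y, K x y * f y‖ₑ ^ p.toReal
        ≤ C ^ p.toReal * ∫⁻ y, ‖f y‖ₑ ^ p.toReal := by
      calc ∫⁻ x, ‖∫ y, K x y * f y‖ₑ ^ p.toReal
          ≤ ∫⁻ x, C ^ (p.toReal - 1) * ∫⁻ y, ‖K x y‖ₑ * ‖f y‖ₑ ^ p.toReal := by
            refine lintegral_mono fun x => ?_
            exact (ENNReal.rpow_le_rpow (hb x) hq0.le).trans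
              (schur_pt _ (hmy x) f hf p hp hpt C (hy x))
        _ = C ^ (p.toReal - 1) * ∫⁻ x, ∫⁻ y, ‖K x y‖ₑ * ‖f y‖ₑ ^ p.toReal :=
            lintegral_const_mul _ hm.lintegral_prod_right'
        _ = C ^ (p.toReal - 1) * ∫⁻ y, ∫⁻ x, ‖K x y‖ₑ * ‖f y‖ₑ ^ p.toReal := by
            rw [lintegral_lintegral_swap hm.aemeasurable]
        _ ≤ C ^ (p.toReal - 1) * ∫⁻ y, C * ‖f y‖ₑ ^ p.toReal := by
            gcongr with y
            rw [lintegral_mul_const _ (hmx y)]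
            gcongr
            exact hx y
        _ = C ^ (p.toReal - 1) * (C * ∫⁻ y, ‖f y‖ₑ ^ p.toReal) := by
            rw [lintegral_const_mul _ (hf.measurable.enorm.pow_const _)]
        _ = C ^ p.toReal * ∫⁻ y, ‖f y‖ₑ ^ p.toReal := by
            rw [← mul_assoc]
            congr 1
            nth_rewrite 2 [← ENNReal.rpow_one C]
            rw [← ENNReal.rpow_add_of_nonneg _ _ (by linarith) (by norm_num)]
            congr 1; ring
    refine (ENNReal.rpow_le_rpow main (by positivity)).trans_eq ?_
    rw [ENNReal.mul_rpow_of_nonneg _ _ (by positivity), ← ENNReal.rpow_mul,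
      mul_one_div_cancel hq0.ne', ENNReal.rpow_one]

noncomputable def hh (n k : ℕ) : ℝ := min 1 (max 0 (2 - (k : ℝ) / n))

lemma hh_one {n k : ℕ} (hn : 1 ≤ n) (hk : k ≤ n) : hh n k = 1 := by
  have hn' : (0 : ℝ) < n := by exact_mod_cast hn
  have : (k : ℝ) / n ≤ 1 := by
    rw [div_le_one hn']; exact_mod_cast hk
  unfold hh
  exact min_eq_left (le_max_of_le_right (by linarith))

lemma hh_good {n : ℕ} (hn : 1 ≤ n) : GoodG n (hh n) := by
  have hn' : (0 : ℝ) < n := by exact_mod_cast hn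
  refine ⟨fun k => ?_, fun k => ?_, fun k hk => ?_⟩
  · rw [abs_of_nonneg (le_min zero_le_one (le_max_left _ _))]
    exact min_le_left _ _
  · have h1 := abs_min_sub_min_le_max 1 (max 0 (2 - (k : ℝ) / n)) 1 (max 0 (2 - ((k + 1 : ℕ) : ℝ) / n))
    have h2 := abs_max_sub_max_le_max 0 (2 - (k : ℝ) / n) 0 (2 - ((k + 1 : ℕ) : ℝ) / n)
    have h3 : |(2 - (k : ℝ) / n) - (2 - ((k + 1 : ℕ) : ℝ) / n)| = 1 / n := by
      rw [show (2 - (k : ℝ) / n) - (2 - ((k + 1 : ℕ) : ℝ) / n) = 1 / n by push_cast; ring]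
      exact abs_of_pos (by positivity)
    have h4 : (0 : ℝ) ≤ 1 / n := by positivity
    rw [h3, sub_self, abs_zero, max_eq_right h4] at h2
    rw [sub_self, abs_zero] at h1
    exact h1.trans (max_le h4 h2)
  · have : 2 ≤ (k : ℝ) / n := by
      rw [le_div_iff₀ hn']; exact_mod_cast hk
    unfold hh
    rw [max_eq_left (by linarith)]
    exact min_eq_right zero_le_one

lemma hh_good' {n : ℕ} (hn : 1 ≤ n) : GoodG n (fun k => hh n (k + 1)) :=
  ⟨fun k => (hh_good hn).bd _, fun k => (hh_good hn).lip _, fun k hk => (hh_good hn).van _ (by omega)⟩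

noncomputable def Kd (n : ℕ) (x y : ℝ) : ℝ :=
  Ak (fun k => hh n (k + 1)) (2 * n + 1) y x - Ak (hh n) (2 * n + 1) x y

lemma Ak_cont (g : ℕ → ℝ) (m : ℕ) : Continuous (fun z : ℝ × ℝ => Ak g m z.1 z.2) := by
  unfold Ak
  refine continuous_finsetSum _ fun k _ => ?_
  exact (continuous_const.mul ((psi_cont _).comp continuous_fst)).mul
    ((psi_cont _).comp continuous_snd)

lemma Kd_cont (n : ℕ) : Continuous (fun z : ℝ × ℝ => Kd n z.1 z.2) :=
  ((Ak_cont _ _).comp continuous_swap).sub (Ak_cont _ _)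

lemma sub_L1 (F G : ℝ → ℝ) (hF : Continuous F) (C : ℝ) (hC : 0 ≤ C)
    (h1 : ∫⁻ y, ‖F y‖ₑ ≤ ENNReal.ofReal (40 * C)) (h2 : ∫⁻ y, ‖G y‖ₑ ≤ ENNReal.ofReal (40 * C)) :
    ∫⁻ y, ‖F y - G y‖ₑ ≤ ENNReal.ofReal (80 * C) := by
  calc ∫⁻ y, ‖F y - G y‖ₑ ≤ ∫⁻ y, (‖F y‖ₑ + ‖G y‖ₑ) := lintegral_mono fun y => enorm_sub_le
    _ = (∫⁻ y, ‖F y‖ₑ) + ∫⁻ y, ‖G y‖ₑ := lintegral_add_left hF.measurable.enorm _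
    _ ≤ ENNReal.ofReal (40 * C) + ENNReal.ofReal (40 * C) := add_le_add h1 h2
    _ = ENNReal.ofReal (80 * C) := by
      rw [← ENNReal.ofReal_add (by positivity) (by positivity)]; congr 1; ring

lemma Kd_L1_y {n : ℕ} (hn : 1 ≤ n) (x : ℝ) :
    ∫⁻ y, ‖Kd n x y‖ₑ ≤ ENNReal.ofReal (80 * Real.sqrt n) :=
  sub_L1 _ _ ((Ak_cont _ _).comp (by fun_prop : Continuous fun y : ℝ => (y, x))) _
    (Real.sqrt_nonneg _) (Ak_L1_x hn (hh_good' hn) x) (Ak_L1_y hn (hh_good hn) x)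

lemma Kd_L1_x {n : ℕ} (hn : 1 ≤ n) (y : ℝ) :
    ∫⁻ x, ‖Kd n x y‖ₑ ≤ ENNReal.ofReal (80 * Real.sqrt n) :=
  sub_L1 _ _ ((Ak_cont _ _).comp (by fun_prop : Continuous fun x : ℝ => (y, x))) _
    (Real.sqrt_nonneg _) (Ak_L1_y hn (hh_good' hn) y) (Ak_L1_x hn (hh_good hn) y)

lemma comb_psi_int (c : ℕ → ℝ) (r m j : ℕ) :
    Integrable (fun x => (∑ k ∈ Finset.range m, c k * psiH (k + r) x) * psiH j x) := by
  simp only [Finset.sum_mul, mul_assoc]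
  exact integrable_finsetSum _ fun i _ => (psi_mul_int _ _).const_mul _

lemma Kd_psi {n : ℕ} (hn : 1 ≤ n) {j : ℕ} (hj : j < n) (x : ℝ) :
    Integrable (fun y => Kd n x y * psiH j y) ∧
    ∫ y, Kd n x y * psiH j y = al j * psiH (j - 1) x - al (j + 1) * psiH (j + 1) x := by
  have e : ∀ y, Kd n x y * psiH j y =
      (∑ k ∈ Finset.range (2 * n + 1), (al (k + 1) * hh n (k + 1) * psiH k x) * psiH (k + 1) y)
        * psiH j y -
      (∑ k ∈ Finset.range (2 * n + 1), (al (k + 1) * hh n k * psiH (k + 1) x) * psiH (k + 0) y)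
        * psiH j y := by
    intro y
    rw [← sub_mul]
    congr 1
    unfold Kd Ak
    congr 1
    exact Finset.sum_congr rfl fun k _ => by ring
  have i1 := comb_psi_int (fun k => al (k + 1) * hh n (k + 1) * psiH k x) 1 (2 * n + 1) j
  have i2 := comb_psi_int (fun k => al (k + 1) * hh n k * psiH (k + 1) x) 0 (2 * n + 1) j
  simp only [e]
  refine ⟨i1.sub i2, ?_⟩
  rw [integral_sub i1 i2, comb_psi (fun k => al (k + 1) * hh n (k + 1) * psiH k x),
    comb_psi (fun k => al (k + 1) * hh n k * psiH (k + 1) x)]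
  congr 1
  · rcases j with _ | j
    · simp [al_zero]
    · simp only [Nat.add_right_cancel_iff]
      rw [Finset.sum_ite_eq', if_pos (Finset.mem_range.2 (by omega)), hh_one hn hj.le]
      simp
  · simp only [add_zero]
    rw [Finset.sum_ite_eq', if_pos (Finset.mem_range.2 (by omega)), hh_one hn hj.le]
    simp

lemma repro {n : ℕ} (hn : 1 ≤ n) (P : ℝ → ℝ) (hP : P ∈ PiH n) :
    ∀ x, Integrable (fun y => Kd n x y * P y) ∧ HasDerivAt P (∫ y, Kd n x y * P y) x := by
  unfold PiH at hP
  induction hP using Submodule.span_induction with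
  | mem f hf =>
    obtain ⟨k, hk, rfl⟩ := hf
    intro x
    obtain ⟨h1, h2⟩ := Kd_psi hn hk x
    refine ⟨h1, ?_⟩
    rw [h2]
    exact psi_deriv k x
  | zero =>
    intro x
    simp only [Pi.zero_apply, mul_zero, integral_zero]
    exact ⟨integrable_zero _ _ _, hasDerivAt_const x 0⟩
  | add f g _ _ hf hg =>
    intro x
    simp only [Pi.add_apply, mul_add]
    refine ⟨(hf x).1.add (hg x).1, ?_⟩
    rw [integral_add (hf x).1 (hg x).1]
    exact (hf x).2.add (hg x).2
  | smul a f _ hf =>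
    intro x
    simp only [Pi.smul_apply, smul_eq_mul, mul_left_comm _ a]
    refine ⟨(hf x).1.const_mul a, ?_⟩
    rw [integral_const_mul]
    exact (hf x).2.const_mul a

theorem stmt10 :
    ∃ c : ℝ, 0 < c ∧ ∀ (n : ℕ), 1 ≤ n → ∀ (p : ℝ≥0∞), 1 ≤ p → ∀ P : ℝ → ℝ, P ∈ PiH n →
      eLpNorm (deriv P) p volume ≤ ENNReal.ofReal (c * Real.sqrt n) * eLpNorm P p volume := by
  refine ⟨80, by norm_num, fun n hn p hp P hP => ?_⟩
  have h := repro hn P hP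
  have hc : Continuous P := continuous_iff_continuousAt.2 fun x => (h x).2.continuousAt
  have e : deriv P = fun x => ∫ y, Kd n x y * P y := funext fun x => (h x).2.deriv
  rw [e]
  exact schur (Kd n) (Kd_cont n) _ (Kd_L1_y hn) (Kd_L1_x hn) P hc p hp
end
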